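/- arXiv:1906.04806 — 2 statements merged into one kernel-verified Lean document; each statement's English description precedes it below -/
import Mathlib

section
/- There exist constants γ > 0 and K > 0 such that for all sufficiently large even n and every integer m with γn ≤ m ≤ 2n log n, the König process satisfies ν(G_m) ≥ (n/2)(1 − e^{−3m/(10n)}) with probability at least 1 − K n^{−2}. -/
open scoped Classical

noncomputable section

/-- `M` is a matching in the graph `G`: a set of edges of `G` that are pairwise disjoint. -/
def IsMatchingOn {n : ℕ} (G : SimpleGraph (Fin n)) (M : Finset (Sym2 (Fin n))) : Prop :=
  (∀ e ∈ M, e ∈ G.edgeSet) ∧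
  ∀ e ∈ M, ∀ f ∈ M, e ≠ f → ∀ v : Fin n, v ∈ e → v ∉ f

/-- ν(G): the maximum size of a matching of `G`. -/
def matchNum {n : ℕ} (G : SimpleGraph (Fin n)) : ℕ :=
  sSup {k | ∃ M : Finset (Sym2 (Fin n)), IsMatchingOn G M ∧ M.card = k}

/-- `C` is a vertex cover of `G`. -/
def IsVertexCover {n : ℕ} (G : SimpleGraph (Fin n)) (C : Finset (Fin n)) : Prop :=
  ∀ e ∈ G.edgeSet, ∃ v ∈ C, v ∈ e

/-- τ(G): the minimum size of a vertex cover of `G`. -/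
def coverNum {n : ℕ} (G : SimpleGraph (Fin n)) : ℕ :=
  sInf {k | ∃ C : Finset (Fin n), IsVertexCover G C ∧ C.card = k}

/-- `G` is a König graph: ν(G) = τ(G). -/
def IsKonig {n : ℕ} (G : SimpleGraph (Fin n)) : Prop := matchNum G = coverNum G

/-- An ordering `e_1, …, e_N` (0-indexed: `σ 0, …, σ (N-1)`) of the `N = n(n-1)/2` edges of
the complete graph on `Fin n`: an injective function from `Fin N` to non-diagonal elements
of `Sym2 (Fin n)`, hence a bijection onto the edge set of `K_n`. -/
def EdgeOrdering (n : ℕ) : Type :=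
  {σ : Fin (n*(n-1)/2) → Sym2 (Fin n) // Function.Injective σ ∧ ∀ i, ¬ (σ i).IsDiag}

/-- The König process: `KonigProc σ m` is the graph `G_m`, where `G_0 = ⊥` and
`G_{m+1} = G_m + e_{m+1}` if that graph is König, `G_{m+1} = G_m` otherwise. -/
def KonigProc {n : ℕ} (σ : EdgeOrdering n) : ℕ → SimpleGraph (Fin n)
  | 0 => ⊥
  | m+1 =>
    if h : m < n*(n-1)/2 then
      (if IsKonig (KonigProc σ m ⊔ SimpleGraph.fromEdgeSet {σ.1 ⟨m, h⟩})
        then KonigProc σ m ⊔ SimpleGraph.fromEdgeSet {σ.1 ⟨m, h⟩}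
        else KonigProc σ m)
    else KonigProc σ m

/-- The probability of an event `A` under the uniformly random edge ordering. -/
def Pr (n : ℕ) (A : EdgeOrdering n → Prop) : ℝ :=
  (Nat.card {σ : EdgeOrdering n // A σ} : ℝ) / (Nat.card (EdgeOrdering n) : ℝ)

/-- A matching of `G`, encoded as the involution exchanging the endpoints of each of its edges
and fixing the unmatched vertices. -/
def IsInvMatching {n : ℕ} (G : SimpleGraph (Fin n)) (f : Fin n → Fin n) : Prop :=
  Function.Involutive f ∧ ∀ v, f v ≠ v → G.Adj v (f v)

/-- The vertices fixed by `f`. -/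
def fixedSet {n : ℕ} (f : Fin n → Fin n) : Finset (Fin n) := Finset.univ.filter (fun v => f v = v)

@[simp] lemma mem_fixedSet {n : ℕ} {f : Fin n → Fin n} {v : Fin n} :
    v ∈ fixedSet f ↔ f v = v := by simp [fixedSet]

/-- Match the vertices `a` and `b` with each other. -/
def link {n : ℕ} (f : Fin n → Fin n) (a b : Fin n) : Fin n → Fin n :=
  fun v => if v = a then b else if v = b then a else f v

lemma link_involutive {n : ℕ} {f : Fin n → Fin n} (hf : Function.Involutive f) {a b : Fin n}
    (ha : f a = a) (hb : f b = b) : Function.Involutive (link f a b) := by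
  intro v
  have h1 : f v = a → v = a := fun h => by rw [← hf v, h, ha]
  have h2 : f v = b → v = b := fun h => by rw [← hf v, h, hb]
  have := hf v
  unfold link
  grind

lemma fixedSet_link {n : ℕ} {f : Fin n → Fin n} {a b : Fin n} (hab : a ≠ b) :
    fixedSet (link f a b) = ((fixedSet f).erase a).erase b := by
  ext v
  simp only [mem_fixedSet, link, Finset.mem_erase]
  grind

lemma card_fixedSet_link {n : ℕ} {f : Fin n → Fin n} {a b : Fin n} (hab : a ≠ b)
    (ha : f a = a) (hb : f b = b) :
    (fixedSet (link f a b)).card + 2 = (fixedSet f).card := by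
  rw [fixedSet_link hab]
  have h1 : a ∈ fixedSet f := by simpa
  have h2 : b ∈ (fixedSet f).erase a := by simp [hab.symm, hb]
  rw [← Finset.card_erase_add_one h1, ← Finset.card_erase_add_one h2]

lemma IsInvMatching.link {n : ℕ} {G H : SimpleGraph (Fin n)} {f : Fin n → Fin n}
    (hf : IsInvMatching G f) (hGH : G ≤ H) {a b : Fin n} (hab : H.Adj a b)
    (ha : f a = a) (hb : f b = b) : IsInvMatching H (link f a b) := by
  refine ⟨link_involutive hf.1 ha hb, fun v hv => ?_⟩
  have := hf.2 v
  have h2 := hab.symm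
  unfold _root_.link at *
  split_ifs at * with h h'
  · exact h ▸ hab
  · exact h' ▸ h2
  · exact hGH (this hv)

lemma IsInvMatching.mono {n : ℕ} {G H : SimpleGraph (Fin n)} {f : Fin n → Fin n}
    (hf : IsInvMatching G f) (hGH : G ≤ H) : IsInvMatching H f :=
  ⟨hf.1, fun v hv => hGH (hf.2 v hv)⟩

lemma isInvMatching_id {n : ℕ} (G : SimpleGraph (Fin n)) : IsInvMatching G id :=
  ⟨fun _ => rfl, fun _ h => absurd rfl h⟩

lemma IsInvMatching.exists_isMatchingOn {n : ℕ} {G : SimpleGraph (Fin n)} {f : Fin n → Fin n}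
    (hf : IsInvMatching G f) :
    ∃ M, IsMatchingOn G M ∧ 2 * M.card + (fixedSet f).card = n := by
  set S := Finset.univ.filter (fun v => f v ≠ v) with hS
  refine ⟨S.image (fun v => s(v, f v)), ⟨?_, ?_⟩, ?_⟩
  · intro e he
    obtain ⟨v, hv, rfl⟩ := Finset.mem_image.1 he
    exact hf.2 v (by simpa [hS] using hv)
  · intro e he e' he' hne v hv hv'
    obtain ⟨a, ha, rfl⟩ := Finset.mem_image.1 he
    obtain ⟨b, hb, rfl⟩ := Finset.mem_image.1 he'
    have h1 := hf.1 a
    have h2 := hf.1 b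
    apply hne
    simp only [Sym2.mem_iff] at hv hv'
    rw [Sym2.eq_iff]
    grind
  · have h1 : S.card = 2 * (S.image (fun v => s(v, f v))).card := by
      rw [Finset.card_eq_sum_card_image (fun v => s(v, f v)) S, Finset.sum_const_nat (m := 2),
        mul_comm]
      intro e he
      obtain ⟨a, ha, rfl⟩ := Finset.mem_image.1 he
      have ha' : f a ≠ a := by simpa [hS] using ha
      have : S.filter (fun v => s(v, f v) = s(a, f a)) = {a, f a} := by
        ext v
        have h1 := hf.1 a
        simp only [hS, Finset.mem_filter, Finset.mem_univ, true_and, Sym2.eq_iff,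
          Finset.mem_insert, Finset.mem_singleton]
        grind
      rw [this, Finset.card_pair ha'.symm]
    have h2 := Finset.card_filter_add_card_filter_not (s := (Finset.univ : Finset (Fin n)))
      (fun v => f v = v)
    simp only [Finset.card_univ, Fintype.card_fin] at h2
    rw [← h1, add_comm]
    exact h2

lemma IsMatchingOn.exists_isInvMatching {n : ℕ} {G : SimpleGraph (Fin n)}
    {M : Finset (Sym2 (Fin n))} (hM : IsMatchingOn G M) :
    ∃ f, IsInvMatching G f ∧ 2 * M.card + (fixedSet f).card = n := by
  suffices h : ∃ f, IsInvMatching G f ∧ 2 * M.card + (fixedSet f).card = n ∧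
      ∀ v, (∀ e ∈ M, v ∉ e) → f v = v by
    obtain ⟨f, h1, h2, -⟩ := h
    exact ⟨f, h1, h2⟩
  induction M using Finset.induction_on with
  | empty =>
    exact ⟨id, isInvMatching_id G, by simp [fixedSet], fun _ _ => rfl⟩
  | insert e M he ih =>
    obtain ⟨f, hf, hc, hfix⟩ := ih ⟨fun e' h => hM.1 e' (Finset.mem_insert_of_mem h),
      fun e' h e'' h' => hM.2 e' (Finset.mem_insert_of_mem h) e'' (Finset.mem_insert_of_mem h')⟩
    induction e using Sym2.ind with
    | _ a b =>
      have hab : G.Adj a b := hM.1 _ (Finset.mem_insert_self _ _)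
      have key : ∀ v, v ∈ s(a, b) → f v = v := fun v hv => hfix v fun e' he' =>
        hM.2 _ (Finset.mem_insert_self _ _) e' (Finset.mem_insert_of_mem he')
          (fun h => he (h ▸ he')) v hv
      have ha := key a (by simp)
      have hb := key b (by simp)
      refine ⟨_root_.link f a b, hf.link le_rfl hab ha hb, ?_, ?_⟩
      · have := card_fixedSet_link hab.ne ha hb
        rw [Finset.card_insert_of_notMem he]
        omega
      · intro v hv
        have h1 := hv s(a, b) (Finset.mem_insert_self _ _)
        simp only [Sym2.mem_iff, not_or] at h1
        simp only [_root_.link, h1.1, h1.2, if_false]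
        exact hfix v fun e' he' => hv e' (Finset.mem_insert_of_mem he')

lemma matchNum_bddAbove {n : ℕ} (G : SimpleGraph (Fin n)) :
    BddAbove {k | ∃ M : Finset (Sym2 (Fin n)), IsMatchingOn G M ∧ M.card = k} := by
  refine ⟨n, ?_⟩
  rintro k ⟨M, hM, rfl⟩
  obtain ⟨f, -, h⟩ := hM.exists_isInvMatching
  omega

lemma IsInvMatching.le_matchNum {n : ℕ} {G : SimpleGraph (Fin n)} {f : Fin n → Fin n}
    (hf : IsInvMatching G f) : n ≤ 2 * matchNum G + (fixedSet f).card := by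
  obtain ⟨M, hM, h⟩ := hf.exists_isMatchingOn
  have : M.card ≤ matchNum G := le_csSup (matchNum_bddAbove G) ⟨M, hM, rfl⟩
  omega

/-- A maximum matching, encoded as an involution. -/
def IsMaxInv {n : ℕ} (G : SimpleGraph (Fin n)) (f : Fin n → Fin n) : Prop :=
  IsInvMatching G f ∧ 2 * matchNum G + (fixedSet f).card = n

lemma exists_isMaxInv {n : ℕ} (G : SimpleGraph (Fin n)) : ∃ f, IsMaxInv G f := by
  have h : matchNum G ∈ {k | ∃ M : Finset (Sym2 (Fin n)), IsMatchingOn G M ∧ M.card = k} :=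
    Nat.sSup_mem ⟨0, ∅, ⟨by simp, by simp⟩, rfl⟩ (matchNum_bddAbove G)
  obtain ⟨M, hM, hc⟩ := h
  obtain ⟨f, hf, h⟩ := hM.exists_isInvMatching
  exact ⟨f, hf, by omega⟩

lemma matchNum_mono {n : ℕ} {G H : SimpleGraph (Fin n)} (h : G ≤ H) :
    matchNum G ≤ matchNum H := by
  obtain ⟨f, hf, hc⟩ := exists_isMaxInv G
  have := (hf.mono h).le_matchNum
  omega

/-- Orbits of two involutions: an orbit containing a fixed point of `g` contains at most one fixed
point of `f`. -/
lemma fixedPoint_unique_of_sameCycle {α : Type*} {f g : Equiv.Perm α}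
    (hf : ∀ v, f (f v) = v) (hg : ∀ v, g (g v) = v) {y z t : α} (hy : f y = y) (hz : f z = z)
    (ht : g t = t) (hyz : (f * g).SameCycle y z) (hyt : (f * g).SameCycle y t) : y = z := by
  have hf' : f⁻¹ = f := Equiv.ext fun v => by rw [Equiv.Perm.inv_eq_iff_eq, hf]
  have hg' : g⁻¹ = g := Equiv.ext fun v => by rw [Equiv.Perm.inv_eq_iff_eq, hg]
  have hff : f * f = 1 := Equiv.ext hf
  have hconj : ∀ i : ℤ, f * (f * g) ^ i = (f * g) ^ (-i) * f := by
    intro i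
    have : f * (f * g) ^ i * f⁻¹ = (f * g) ^ (-i) := by
      rw [← conj_zpow, zpow_neg, ← inv_zpow]
      congr 1
      rw [mul_inv_rev, hf', hg', ← mul_assoc, hff, one_mul]
    rw [← this, inv_mul_cancel_right]
  obtain ⟨i, rfl⟩ := hyt
  obtain ⟨j, rfl⟩ := hyz
  set c := f * g with hc
  have hst : ∀ k : ℤ, (c ^ k) y = y ↔ c ^ k ∈ MulAction.stabilizer (Equiv.Perm α) y := by
    intro k; simp [MulAction.mem_stabilizer_iff]
  have e1 : (c ^ (2 * j)) y = y := by
    have : (c ^ (-j)) y = (c ^ j) y := by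
      conv_rhs => rw [← hz]
      rw [← Equiv.Perm.mul_apply f, hconj j, Equiv.Perm.mul_apply, hy]
    rw [two_mul, zpow_add, Equiv.Perm.mul_apply, ← this, ← Equiv.Perm.mul_apply, ← zpow_add]
    simp
  have e2 : (c ^ (2 * i + 1)) y = y := by
    have hgc : g = f * c := by rw [hc, ← mul_assoc, hff, one_mul]
    have : (c ^ (-(i + 1))) y = (c ^ i) y := by
      conv_rhs => rw [← ht]
      rw [← Equiv.Perm.mul_apply g, hgc, mul_assoc, ← zpow_one_add, add_comm 1 i, hconj (i + 1),
        Equiv.Perm.mul_apply, hy]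
    have h2 : (2 * i + 1 : ℤ) = (i + 1) + i := by ring
    rw [h2, zpow_add, Equiv.Perm.mul_apply, ← this, ← Equiv.Perm.mul_apply, ← zpow_add]
    simp
  rw [hst] at e1 e2
  have e3 := mul_mem (zpow_mem e2 j) (inv_mem (zpow_mem e1 i))
  rw [← zpow_mul, ← zpow_mul, ← zpow_neg, ← zpow_add] at e3
  have : (2 * i + 1) * j + -(2 * j * i) = j := by ring
  rw [this, ← hst] at e3
  exact e3.symm

/-- The orbit of `y` under the composition of two involutions. -/
def altOrbit {α : Type*} {f g : α → α} (hf : Function.Involutive f)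
    (hg : Function.Involutive g) (y : α) : Set α :=
  {v | (hf.toPerm * hg.toPerm).SameCycle y v}

/-- If `f y = y`, the orbit of `y` under the two involutions `f` and `g` is closed under both, and
contains at most one fixed point of either as soon as it contains a fixed point of the other. -/
lemma altOrbit_spec {α : Type*} {f g : α → α} (hf : Function.Involutive f)
    (hg : Function.Involutive g) {y : α} (hy : f y = y) :
    y ∈ altOrbit hf hg y ∧ (∀ v ∈ altOrbit hf hg y, f v ∈ altOrbit hf hg y) ∧
      (∀ v ∈ altOrbit hf hg y, g v ∈ altOrbit hf hg y) ∧
      (∀ x ∈ altOrbit hf hg y, ∀ z ∈ altOrbit hf hg y, ∀ t ∈ altOrbit hf hg y,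
        f x = x → f z = z → g t = t → x = z) ∧
      (∀ x ∈ altOrbit hf hg y, ∀ z ∈ altOrbit hf hg y, ∀ t ∈ altOrbit hf hg y,
        g x = x → g z = z → f t = t → x = z) := by
  unfold altOrbit
  set F : Equiv.Perm α := hf.toPerm with hF
  set H : Equiv.Perm α := hg.toPerm with hH
  have hFf : ∀ v, F v = f v := fun _ => rfl
  have hHg : ∀ v, H v = g v := fun _ => rfl
  have hf' : F⁻¹ = F := Equiv.ext fun v => by rw [Equiv.Perm.inv_eq_iff_eq]; exact (hf v).symm
  have hg' : H⁻¹ = H := Equiv.ext fun v => by rw [Equiv.Perm.inv_eq_iff_eq]; exact (hg v).symm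
  have hFF : F * F = 1 := Equiv.ext hf
  have hinv : (F * H)⁻¹ = H * F := by rw [mul_inv_rev, hf', hg']
  have hclF : ∀ v, (F * H).SameCycle y v → (F * H).SameCycle y (F v) := by
    rintro v ⟨i, rfl⟩
    refine ⟨-i, ?_⟩
    have : F * (F * H) ^ i * F⁻¹ = (F * H) ^ (-i) := by
      rw [← conj_zpow, zpow_neg, ← inv_zpow, hinv]
      congr 1
      rw [hf', ← mul_assoc, hFF, one_mul]
    rw [← this, hf']
    simp [hFf, hy]
  have hpair : ∀ a b, (F * H).SameCycle y a → (F * H).SameCycle y b → (F * H).SameCycle a b :=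
    fun a b ha hb => ha.symm.trans hb
  refine ⟨Equiv.Perm.SameCycle.refl _ _, hclF, ?_, ?_, ?_⟩
  · intro v hv
    have h1 : (F * H).SameCycle y (F (H v)) := by
      have := (Equiv.Perm.sameCycle_apply_right (f := F * H) (x := y) (y := v)).2 hv
      simpa using this
    have h2 := hclF _ h1
    have : F (F (H v)) = g v := by rw [hFf, hFf, hHg, hf]
    rwa [this] at h2
  · intro x hx z hz t ht h1 h2 h3
    exact fixedPoint_unique_of_sameCycle (f := F) (g := H) hf hg h1 h2 h3 (hpair _ _ hx hz)
      (hpair _ _ hx ht)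
  · intro x hx z hz t ht h1 h2 h3
    refine fixedPoint_unique_of_sameCycle (f := H) (g := F) hg hf h1 h2 h3 ?_ ?_
    · rw [← hinv, Equiv.Perm.sameCycle_inv]; exact hpair _ _ hx hz
    · rw [← hinv, Equiv.Perm.sameCycle_inv]; exact hpair _ _ hx ht

/-- The map equal to `g` on `K` and to `f` elsewhere. -/
def switchMap {n : ℕ} (K : Set (Fin n)) (f g : Fin n → Fin n) : Fin n → Fin n :=
  fun v => if v ∈ K then g v else f v

lemma IsInvMatching.switchOn {n : ℕ} {G : SimpleGraph (Fin n)} {f g : Fin n → Fin n}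
    (hf : IsInvMatching G f) (hg : IsInvMatching G g) {K : Set (Fin n)}
    (hKf : ∀ v ∈ K, f v ∈ K) (hKg : ∀ v ∈ K, g v ∈ K) : IsInvMatching G (switchMap K f g) := by
  refine ⟨fun v => ?_, fun v => ?_⟩
  · by_cases hv : v ∈ K
    · simp [switchMap, hv, hKg v hv, hg.1 v]
    · have : f v ∉ K := fun h => hv (by simpa [hf.1 v] using hKf _ h)
      simp [switchMap, hv, this, hf.1 v]
  · by_cases hv : v ∈ K
    · simpa [switchMap, hv] using hg.2 v
    · simpa [switchMap, hv] using hf.2 v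

/-- A matching which is not maximum can be enlarged while keeping all matched vertices matched. -/
lemma IsInvMatching.exists_ssubset {n : ℕ} {G : SimpleGraph (Fin n)} {f g : Fin n → Fin n}
    (hf : IsInvMatching G f) (hg : IsInvMatching G g)
    (hlt : (fixedSet g).card < (fixedSet f).card) :
    ∃ h, IsInvMatching G h ∧ fixedSet h ⊂ fixedSet f := by
  have hsp := fun y : {y // f y = y} => altOrbit_spec hf.1 hg.1 y.2
  by_cases hex : ∃ y : {y // f y = y}, ∀ t ∈ altOrbit hf.1 hg.1 y.1, g t ≠ t
  · obtain ⟨y, hy⟩ := hex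
    refine ⟨_, hf.switchOn hg (hsp y).2.1 (hsp y).2.2.1, ?_⟩
    rw [Finset.ssubset_iff_of_subset]
    · refine ⟨y, by simpa using y.2, ?_⟩
      simpa [switchMap, (hsp y).1] using hy y (hsp y).1
    · intro v
      simp only [mem_fixedSet, switchMap]
      split_ifs with hv
      · exact fun h => absurd h (hy v hv)
      · exact id
  · push Not at hex
    choose t htK ht using hex
    have hinj : Function.Injective t := by
      intro y z hyz
      refine Subtype.ext ((hsp y).2.2.2.1 y (hsp y).1 z ?_ _ (htK y) y.2 z.2 (ht y))
      have h1 : (hf.1.toPerm * hg.1.toPerm).SameCycle y.1 (t y) := htK y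
      have h2 : (hf.1.toPerm * hg.1.toPerm).SameCycle z.1 (t z) := htK z
      exact h1.trans (hyz ▸ h2.symm)
    have hle : (fixedSet f).card ≤ (fixedSet g).card := by
      refine Finset.card_le_card_of_injOn (fun v => if h : f v = v then t ⟨v, h⟩ else v) ?_ ?_
      · intro v hv
        have hv' : f v = v := by simpa using hv
        simpa [hv'] using ht ⟨v, hv'⟩
      · intro v hv w hw h
        have hv' : f v = v := by simpa using hv
        have hw' : f w = w := by simpa using hw
        simp only [hv', hw', dif_pos] at h
        exact congrArg Subtype.val (hinj h)
    omega

lemma IsInvMatching.exists_isMaxInv_subset {n : ℕ} {G : SimpleGraph (Fin n)} {f : Fin n → Fin n}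
    (hf : IsInvMatching G f) : ∃ h, IsMaxInv G h ∧ fixedSet h ⊆ fixedSet f := by
  induction hk : (fixedSet f).card using Nat.strong_induction_on generalizing f with
  | _ k ih =>
    obtain ⟨g, hg⟩ := exists_isMaxInv G
    by_cases hlt : (fixedSet g).card < (fixedSet f).card
    · obtain ⟨h, hh, hss⟩ := hf.exists_ssubset hg.1 hlt
      obtain ⟨h', hh', hs⟩ := ih _ (hk ▸ Finset.card_lt_card hss) hh rfl
      exact ⟨h', hh', hs.trans hss.subset⟩
    · have h1 := hf.le_matchNum
      have h2 := hg.2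
      exact ⟨f, ⟨hf, by omega⟩, subset_rfl⟩

/-- If `y` is missed by some maximum matching, and some maximum matching misses `x ≠ z`, then some
maximum matching misses `y` together with one of `x`, `z`. -/
lemma IsMaxInv.exchange {n : ℕ} {G : SimpleGraph (Fin n)} {f g : Fin n → Fin n}
    (hf : IsMaxInv G f) (hg : IsMaxInv G g) {x y z : Fin n} (hxz : x ≠ z) (hx : f x = x)
    (hz : f z = z) (hy : g y = y) :
    ∃ h, IsMaxInv G h ∧ h y = y ∧ (h x = x ∨ h z = z) := by
  obtain ⟨hyK, hKg, hKf, -, huniq⟩ := altOrbit_spec hg.1.1 hf.1.1 hy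
  set K := altOrbit hg.1.1 hf.1.1 y
  have h1 := hf.1.switchOn hg.1 hKf hKg
  have h2 := hg.1.switchOn hf.1 hKg hKf
  have hsum : (fixedSet (switchMap K f g)).card + (fixedSet (switchMap K g f)).card =
      (fixedSet f).card + (fixedSet g).card := by
    simp only [fixedSet, Finset.card_filter, ← Finset.sum_add_distrib]
    refine Finset.sum_congr rfl fun v _ => ?_
    by_cases hv : v ∈ K
    · simp [switchMap, hv, add_comm]
    · simp [switchMap, hv]
  have e1 := h1.le_matchNum
  have e2 := h2.le_matchNum
  have e3 := hf.2
  have e4 := hg.2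
  refine ⟨_, ⟨h1, by omega⟩, by simp [switchMap, hyK, hy], ?_⟩
  by_cases hxK : x ∈ K
  · by_cases hzK : z ∈ K
    · exact absurd (huniq x hxK z hzK y hyK hx hz hy) hxz
    · right; simp [switchMap, hzK, hz]
  · left; simp [switchMap, hxK, hx]

lemma IsInvMatching.two_mul_card_cover {n : ℕ} {G : SimpleGraph (Fin n)} {f : Fin n → Fin n}
    (hf : IsInvMatching G f) {C : Finset (Fin n)} (hC : IsVertexCover G C) :
    n + (C ∩ fixedSet f).card * 2 ≤ 2 * C.card + (fixedSet f).card := by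
  have h1 : ((Finset.univ \ fixedSet f) \ C).card ≤ (C \ fixedSet f).card := by
    refine Finset.card_le_card_of_injOn f ?_ hf.1.injective.injOn
    intro v hv
    simp only [Finset.coe_sdiff, Set.mem_sdiff, Finset.mem_coe, Finset.mem_univ, mem_fixedSet,
      true_and] at hv ⊢
    obtain ⟨w, hw, hwe⟩ := hC s(v, f v) (hf.2 v hv.1)
    rw [hf.1 v]
    rcases Sym2.mem_iff.1 hwe with rfl | rfl
    · exact absurd hw hv.2
    · exact ⟨hw, fun h => hv.1 h.symm⟩
  have h2 := Finset.card_sdiff_add_card_inter (Finset.univ \ fixedSet f) C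
  have h3 := Finset.card_sdiff_add_card_inter C (fixedSet f)
  have h4 : (Finset.univ \ fixedSet f) ∩ C = C \ fixedSet f := by
    ext v; simp [and_comm]
  have h5 := Finset.card_sdiff_add_card_eq_card (Finset.subset_univ (fixedSet f))
  simp only [Finset.card_univ, Fintype.card_fin] at h5
  rw [h4] at h2
  omega

lemma coverNum_le {n : ℕ} {G : SimpleGraph (Fin n)} {C : Finset (Fin n)}
    (hC : IsVertexCover G C) : coverNum G ≤ C.card := Nat.sInf_le ⟨C, hC, rfl⟩

lemma exists_cover {n : ℕ} (G : SimpleGraph (Fin n)) :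
    ∃ C, IsVertexCover G C ∧ C.card = coverNum G :=
  Nat.sInf_mem (s := {k | ∃ C : Finset (Fin n), IsVertexCover G C ∧ C.card = k})
    ⟨_, Finset.univ, fun e _ => by
      induction e using Sym2.ind with
      | _ a b => exact ⟨a, by simp, by simp⟩, rfl⟩

lemma matchNum_le_coverNum {n : ℕ} (G : SimpleGraph (Fin n)) : matchNum G ≤ coverNum G := by
  obtain ⟨C, hC, h⟩ := exists_cover G
  obtain ⟨f, hf, h2⟩ := exists_isMaxInv G
  have := hf.two_mul_card_cover hC
  omega

lemma IsKonig.exists_cover {n : ℕ} {G : SimpleGraph (Fin n)} (hG : IsKonig G) :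
    ∃ C, IsVertexCover G C ∧ C.card = matchNum G ∧ ∀ f, IsMaxInv G f → ∀ v ∈ C, f v ≠ v := by
  obtain ⟨C, hC, h⟩ := _root_.exists_cover G
  have h' : C.card = matchNum G := by rw [h, hG]
  refine ⟨C, hC, h', fun f hf v hv hfv => ?_⟩
  have h1 := hf.1.two_mul_card_cover hC
  have h2 := hf.2
  have : 0 < (C ∩ fixedSet f).card := Finset.card_pos.2 ⟨v, by simp [hv, hfv]⟩
  omega

/-- The graph `G` with the edge `e` added. -/
abbrev addEdge {n : ℕ} (G : SimpleGraph (Fin n)) (e : Sym2 (Fin n)) : SimpleGraph (Fin n) :=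
  G ⊔ SimpleGraph.fromEdgeSet {e}

lemma isVertexCover_addEdge {n : ℕ} {G : SimpleGraph (Fin n)} {C : Finset (Fin n)}
    (hC : IsVertexCover G C) {a b : Fin n} (ha : a ∈ C) :
    IsVertexCover (addEdge G s(a, b)) C := by
  intro e he
  rw [SimpleGraph.edgeSet_sup] at he
  rcases he with he | he
  · exact hC e he
  · rw [SimpleGraph.edgeSet_fromEdgeSet] at he
    obtain rfl : e = s(a, b) := he.1
    exact ⟨a, ha, by simp⟩

lemma addEdge_adj {n : ℕ} (G : SimpleGraph (Fin n)) {a b : Fin n} (hab : a ≠ b) :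
    (addEdge G s(a, b)).Adj a b := by simp [hab]

/-- An edge meeting a minimum vertex cover of a König graph is accepted. -/
lemma isKonig_addEdge_of_cover {n : ℕ} {G : SimpleGraph (Fin n)} {C : Finset (Fin n)}
    (hC : IsVertexCover G C) (hcard : C.card = matchNum G) {a b : Fin n} (ha : a ∈ C) :
    IsKonig (addEdge G s(a, b)) ∧ matchNum (addEdge G s(a, b)) = matchNum G := by
  have h1 := coverNum_le (isVertexCover_addEdge hC ha (b := b))
  have h2 := matchNum_le_coverNum (addEdge G s(a, b))
  have h3 : matchNum G ≤ matchNum (addEdge G s(a, b)) := matchNum_mono le_sup_left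
  unfold IsKonig
  omega

/-- An edge between two vertices missed by a maximum matching is accepted. -/
lemma isKonig_addEdge_of_missed {n : ℕ} {G : SimpleGraph (Fin n)} (hG : IsKonig G)
    {f : Fin n → Fin n} (hf : IsMaxInv G f) {a b : Fin n} (hab : a ≠ b) (ha : f a = a)
    (hb : f b = b) :
    IsKonig (addEdge G s(a, b)) ∧ matchNum (addEdge G s(a, b)) = matchNum G + 1 := by
  obtain ⟨C, hC, hcard, -⟩ := hG.exists_cover
  have h1 := coverNum_le (isVertexCover_addEdge (C := insert a C) (a := a) (b := b)
    (fun e he => by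
      obtain ⟨v, hv, hve⟩ := hC e he
      exact ⟨v, Finset.mem_insert_of_mem hv, hve⟩) (Finset.mem_insert_self a C))
  have h2 := matchNum_le_coverNum (addEdge G s(a, b))
  have h3 := (hf.1.link (H := addEdge G s(a, b)) le_sup_left (addEdge_adj G hab) ha hb).le_matchNum
  have h4 := card_fixedSet_link hab ha hb
  have h5 := Finset.card_insert_le a C
  have h6 := hf.2
  unfold IsKonig
  omega

/-- `μ` is a probability distribution on the maximum matchings of `G`. -/
def IsDist {n : ℕ} (G : SimpleGraph (Fin n)) (μ : (Fin n → Fin n) → ℝ) : Prop :=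
  (∀ f, 0 ≤ μ f) ∧ ∑ f, μ f = 1 ∧ ∀ f, ¬ IsMaxInv G f → μ f = 0

/-- The probability that a `μ`-random matching misses `v`. -/
def missProb {n : ℕ} (μ : (Fin n → Fin n) → ℝ) (v : Fin n) : ℝ :=
  ∑ f, μ f * if f v = v then 1 else 0

/-- The collision sum of the missing probabilities. -/
def energy {n : ℕ} (μ : (Fin n → Fin n) → ℝ) : ℝ := ∑ v, missProb μ v ^ 2

/-- The minimum collision sum over all distributions on maximum matchings of `G`. -/
def minEnergy {n : ℕ} (G : SimpleGraph (Fin n)) : ℝ := sInf (energy '' {μ | IsDist G μ})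

/-- The number of vertices missed by a maximum matching. -/
def deficiency {n : ℕ} (G : SimpleGraph (Fin n)) : ℝ := n - 2 * matchNum G

lemma missProb_nonneg {n : ℕ} {μ : (Fin n → Fin n) → ℝ} (h : ∀ f, 0 ≤ μ f) (v : Fin n) :
    0 ≤ missProb μ v :=
  Finset.sum_nonneg fun f _ => mul_nonneg (h f) (by split_ifs <;> norm_num)

lemma energy_nonneg {n : ℕ} (μ : (Fin n → Fin n) → ℝ) : 0 ≤ energy μ :=
  Finset.sum_nonneg fun _ _ => sq_nonneg _

lemma minEnergy_le {n : ℕ} {G : SimpleGraph (Fin n)} {μ : (Fin n → Fin n) → ℝ}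
    (h : IsDist G μ) : minEnergy G ≤ energy μ :=
  csInf_le ⟨0, by rintro _ ⟨μ, -, rfl⟩; exact energy_nonneg μ⟩ ⟨μ, h, rfl⟩

lemma IsMaxInv.card_fixedSet {n : ℕ} {G : SimpleGraph (Fin n)} {f : Fin n → Fin n}
    (hf : IsMaxInv G f) : ((fixedSet f).card : ℝ) = deficiency G := by
  have : (2 * matchNum G + (fixedSet f).card : ℝ) = n := by exact_mod_cast hf.2
  unfold deficiency
  linarith

lemma deficiency_nonneg {n : ℕ} (G : SimpleGraph (Fin n)) : 0 ≤ deficiency G := by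
  obtain ⟨f, hf⟩ := exists_isMaxInv G
  rw [← hf.card_fixedSet]
  positivity

lemma deficiency_le {n : ℕ} (G : SimpleGraph (Fin n)) : deficiency G ≤ n := by
  unfold deficiency
  have : (0:ℝ) ≤ matchNum G := by positivity
  linarith

lemma deficiency_anti {n : ℕ} {G H : SimpleGraph (Fin n)} (h : G ≤ H) :
    deficiency H ≤ deficiency G := by
  have : (matchNum G : ℝ) ≤ matchNum H := by exact_mod_cast matchNum_mono h
  unfold deficiency
  linarith

/-- The push-forward of `μ` under `φ`. -/
def pushDist {n : ℕ} (φ : (Fin n → Fin n) → (Fin n → Fin n)) (μ : (Fin n → Fin n) → ℝ) :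
    (Fin n → Fin n) → ℝ := fun g => ∑ f, if φ f = g then μ f else 0

lemma sum_pushDist {n : ℕ} (φ : (Fin n → Fin n) → (Fin n → Fin n)) (μ : (Fin n → Fin n) → ℝ)
    (F : (Fin n → Fin n) → ℝ) : ∑ g, pushDist φ μ g * F g = ∑ f, μ f * F (φ f) := by
  simp only [pushDist, Finset.sum_mul]
  rw [Finset.sum_comm]
  refine Finset.sum_congr rfl fun f _ => ?_
  simp [ite_mul]

lemma IsDist.push {n : ℕ} {G H : SimpleGraph (Fin n)} {μ : (Fin n → Fin n) → ℝ}
    (h : IsDist G μ) {φ : (Fin n → Fin n) → (Fin n → Fin n)}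
    (hφ : ∀ f, IsMaxInv G f → IsMaxInv H (φ f)) : IsDist H (pushDist φ μ) := by
  refine ⟨fun g => Finset.sum_nonneg fun f _ => ?_, ?_, fun g hg => ?_⟩
  · split_ifs
    exacts [h.1 f, le_rfl]
  · simpa [h.2.1] using sum_pushDist φ μ (fun _ => 1)
  · refine Finset.sum_eq_zero fun f _ => ?_
    split_ifs with hf
    · exact h.2.2 f fun hm => hg (hf ▸ hφ f hm)
    · rfl

lemma exists_isDist {n : ℕ} (G : SimpleGraph (Fin n)) : ∃ μ, IsDist G μ := by
  obtain ⟨f, hf⟩ := exists_isMaxInv G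
  refine ⟨fun g => if g = f then 1 else 0, fun g => ?_, by simp, fun g hg => ?_⟩
  · dsimp only
    split_ifs <;> norm_num
  · exact if_neg (by rintro rfl; exact hg hf)

lemma exists_optimal {n : ℕ} (G : SimpleGraph (Fin n)) :
    ∃ μ, IsDist G μ ∧ energy μ = minEnergy G := by
  have hset : {μ | IsDist G μ} = stdSimplex ℝ (Fin n → Fin n) ∩
      ⋂ f : {f // ¬ IsMaxInv G f}, {μ : (Fin n → Fin n) → ℝ | μ f.1 = 0} := by
    ext μ
    simp [IsDist, stdSimplex, and_assoc]
  have hcomp : IsCompact {μ | IsDist G μ} := by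
    rw [hset]
    refine (isCompact_stdSimplex ℝ _).inter_right (isClosed_iInter fun f => ?_)
    exact isClosed_eq (continuous_apply _) continuous_const
  have hcont : Continuous (energy (n := n)) := by
    unfold energy missProb
    fun_prop
  obtain ⟨μ, hμ, hm⟩ := hcomp.exists_isMinOn (exists_isDist G) hcont.continuousOn
  refine ⟨μ, hμ, le_antisymm ?_ (minEnergy_le hμ)⟩
  refine le_csInf ⟨_, μ, hμ, rfl⟩ ?_
  rintro _ ⟨μ', h', rfl⟩
  exact hm h'

lemma minEnergy_nonneg {n : ℕ} (G : SimpleGraph (Fin n)) : 0 ≤ minEnergy G := by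
  obtain ⟨μ, -, h⟩ := exists_optimal G
  exact h ▸ energy_nonneg μ

lemma IsDist.sum_missProb {n : ℕ} {G : SimpleGraph (Fin n)} {μ : (Fin n → Fin n) → ℝ}
    (h : IsDist G μ) : ∑ v, missProb μ v = deficiency G := by
  have h2 : ∀ f, μ f * ((fixedSet f).card : ℝ) = μ f * deficiency G := fun f => by
    by_cases hf : IsMaxInv G f
    · rw [hf.card_fixedSet]
    · simp [h.2.2 f hf]
  unfold missProb
  rw [Finset.sum_comm]
  simp_rw [← Finset.mul_sum, Finset.sum_boole]
  change ∑ f, μ f * ((fixedSet f).card : ℝ) = _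
  simp_rw [h2, ← Finset.sum_mul, h.2.1, one_mul]

lemma IsDist.missProb_le_one {n : ℕ} {G : SimpleGraph (Fin n)} {μ : (Fin n → Fin n) → ℝ}
    (h : IsDist G μ) (v : Fin n) : missProb μ v ≤ 1 := by
  rw [← h.2.1]
  refine Finset.sum_le_sum fun f _ => ?_
  have := h.1 f
  split_ifs <;> linarith

lemma minEnergy_le_deficiency {n : ℕ} (G : SimpleGraph (Fin n)) :
    minEnergy G ≤ deficiency G := by
  obtain ⟨μ, hμ⟩ := exists_isDist G
  refine (minEnergy_le hμ).trans (hμ.sum_missProb ▸ Finset.sum_le_sum fun v _ => ?_)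
  have h1 := missProb_nonneg hμ.1 v
  have h2 := hμ.missProb_le_one v
  nlinarith

lemma minEnergy_anti {n : ℕ} {G H : SimpleGraph (Fin n)} (h : G ≤ H) :
    minEnergy H ≤ minEnergy G := by
  obtain ⟨μ, hμ, he⟩ := exists_optimal G
  have hex : ∀ f, ∃ g, IsMaxInv G f → IsMaxInv H g ∧ fixedSet g ⊆ fixedSet f := fun f => by
    by_cases hf : IsMaxInv G f
    · obtain ⟨g, hg⟩ := (hf.1.mono h).exists_isMaxInv_subset
      exact ⟨g, fun _ => hg⟩
    · exact ⟨f, fun h => absurd h hf⟩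
  choose φ hφ using hex
  have hd := hμ.push (fun f hf => (hφ f hf).1)
  refine (minEnergy_le hd).trans (he ▸ Finset.sum_le_sum fun v _ => ?_)
  refine pow_le_pow_left₀ (missProb_nonneg hd.1 v) ?_ 2
  unfold missProb
  rw [sum_pushDist φ μ (fun g => if g v = v then 1 else 0)]
  refine Finset.sum_le_sum fun f _ => ?_
  by_cases hf : IsMaxInv G f
  · refine mul_le_mul_of_nonneg_left ?_ (hμ.1 f)
    have := @(hφ f hf).2 v
    simp only [mem_fixedSet] at this
    split_ifs with h1 h2 <;> first | exact absurd (this h1) h2 | norm_num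
  · simp [hμ.2.2 f hf]

/-- One step of the process. -/
def nextGraph {n : ℕ} (G : SimpleGraph (Fin n)) (e : Sym2 (Fin n)) : SimpleGraph (Fin n) :=
  if IsKonig (addEdge G e) then addEdge G e else G

lemma le_nextGraph {n : ℕ} (G : SimpleGraph (Fin n)) (e : Sym2 (Fin n)) : G ≤ nextGraph G e := by
  unfold nextGraph
  split_ifs
  exacts [le_sup_left, le_rfl]

/-- The edges of the complete graph. -/
def allEdges (n : ℕ) : Finset (Sym2 (Fin n)) := Finset.univ.filter fun e => ¬ e.IsDiag

/-- The vertices `x` and `y` are both missed by some maximum matching. -/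
def JointlyMissed {n : ℕ} (G : SimpleGraph (Fin n)) (x y : Fin n) : Prop :=
  x ≠ y ∧ ∃ f, IsMaxInv G f ∧ f x = x ∧ f y = y

lemma deficiency_nextGraph {n : ℕ} {G : SimpleGraph (Fin n)} (hG : IsKonig G) {x y : Fin n}
    (h : JointlyMissed G x y) : deficiency G - deficiency (nextGraph G s(x, y)) = 2 := by
  obtain ⟨hxy, f, hf, hx, hy⟩ := h
  obtain ⟨h1, h2⟩ := isKonig_addEdge_of_missed hG hf hxy hx hy
  rw [nextGraph, if_pos h1, deficiency, deficiency, h2]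
  push_cast
  ring

lemma IsMaxInv.unique_not_jointlyMissed {n : ℕ} {G : SimpleGraph (Fin n)} {f g : Fin n → Fin n}
    (hf : IsMaxInv G f) (hg : IsMaxInv G g) {x y z : Fin n} (hx : g x = x) (hy : f y = y)
    (hz : f z = z) (hxy : ¬ JointlyMissed G x y) (hxz : ¬ JointlyMissed G x z) : y = z := by
  by_contra hne
  by_cases h1 : x = y
  · subst h1
    exact hxz ⟨hne, f, hf, hy, hz⟩
  by_cases h2 : x = z
  · subst h2
    exact hxy ⟨h1, f, hf, hz, hy⟩
  obtain ⟨h, hh, hhx, hh' | hh'⟩ := hf.exchange hg hne hy hz hx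
  · exact hxy ⟨h1, h, hh, hhx, hh'⟩
  · exact hxz ⟨h2, h, hh, hhx, hh'⟩

lemma IsDist.sum_not_jointlyMissed_le {n : ℕ} {G : SimpleGraph (Fin n)}
    {μ : (Fin n → Fin n) → ℝ} (h : IsDist G μ) (x : Fin n) :
    missProb μ x * ∑ y, (if JointlyMissed G x y then 0 else missProb μ y) ≤ missProb μ x := by
  rcases eq_or_ne (missProb μ x) 0 with h0 | h0
  · simp [h0]
  have hg : ∃ g, IsMaxInv G g ∧ g x = x := by
    by_contra hcon
    push Not at hcon
    refine h0 (Finset.sum_eq_zero fun f _ => ?_)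
    by_cases hf : IsMaxInv G f
    · simp [hcon f hf]
    · simp [h.2.2 f hf]
  obtain ⟨g, hg, hgx⟩ := hg
  refine mul_le_of_le_one_right (missProb_nonneg h.1 x) ?_
  calc ∑ y, (if JointlyMissed G x y then 0 else missProb μ y)
      = ∑ f, μ f * ∑ y, (if f y = y ∧ ¬ JointlyMissed G x y then 1 else 0) := by
        simp_rw [Finset.mul_sum]
        rw [Finset.sum_comm]
        refine Finset.sum_congr rfl fun y _ => ?_
        unfold missProb
        split_ifs with hj <;> simp [hj]
    _ ≤ ∑ f, μ f * 1 := by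
        refine Finset.sum_le_sum fun f _ => ?_
        by_cases hf : IsMaxInv G f
        · refine mul_le_mul_of_nonneg_left ?_ (h.1 f)
          rw [Finset.sum_boole]
          norm_cast
          refine Finset.card_le_one.2 fun y hy z hz => ?_
          simp only [Finset.mem_filter, Finset.mem_univ, true_and] at hy hz
          exact hf.unique_not_jointlyMissed hg hgx hy.1 hz.1 hy.2 hz.2
        · simp [h.2.2 f hf]
    _ = 1 := by simp [h.2.1]

/-- Expected decrease of the deficiency in one step. -/
theorem sum_deficiency_drop {n : ℕ} {G : SimpleGraph (Fin n)} (hG : IsKonig G)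
    (hU : 1 ≤ deficiency G) :
    (deficiency G ^ 2 - deficiency G) ^ 2 ≤
      (∑ e ∈ allEdges n, min (deficiency G - deficiency (nextGraph G e)) 2) *
        minEnergy G ^ 2 := by
  obtain ⟨μ, hμ, hopt⟩ := exists_optimal G
  set p := missProb μ with hp
  set A : Finset (Fin n × Fin n) := Finset.univ.filter fun q => JointlyMissed G q.1 q.2 with hA
  have hsum : ∑ x, p x = deficiency G := hμ.sum_missProb
  have h1 : deficiency G ^ 2 - deficiency G ≤ ∑ q ∈ A, p q.1 * p q.2 := by
    have h2 : ∑ q : Fin n × Fin n, p q.1 * p q.2 = deficiency G ^ 2 := by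
      rw [sq, ← hsum, Finset.sum_mul_sum, Fintype.sum_prod_type]
    have h3 : ∑ q ∈ A, p q.1 * p q.2 + ∑ q : Fin n × Fin n,
        p q.1 * (if JointlyMissed G q.1 q.2 then 0 else p q.2) = deficiency G ^ 2 := by
      rw [← h2, hA, Finset.sum_filter, ← Finset.sum_add_distrib]
      refine Finset.sum_congr rfl fun q _ => ?_
      split_ifs <;> simp
    have h4 : ∑ q : Fin n × Fin n, p q.1 * (if JointlyMissed G q.1 q.2 then 0 else p q.2)
        ≤ deficiency G := by
      rw [Fintype.sum_prod_type, ← hsum]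
      refine Finset.sum_le_sum fun x _ => ?_
      dsimp only
      rw [← Finset.mul_sum]
      exact hμ.sum_not_jointlyMissed_le x
    linarith
  have h5 : (∑ q ∈ A, p q.1 * p q.2) ^ 2 ≤ A.card * minEnergy G ^ 2 := by
    refine sq_sum_le_card_mul_sum_sq.trans (mul_le_mul_of_nonneg_left ?_ (by positivity))
    rw [← hopt, sq (energy μ), energy, Finset.sum_mul_sum, ← Fintype.sum_prod_type
      (fun q : Fin n × Fin n => missProb μ q.1 ^ 2 * missProb μ q.2 ^ 2)]
    simp_rw [mul_pow]
    exact Finset.sum_le_sum_of_subset_of_nonneg (Finset.subset_univ _) fun _ _ _ => by positivity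
  have h6 : A.card ≤ 2 * (A.image fun q => s(q.1, q.2)).card := by
    refine Finset.card_le_mul_card_image A 2 fun e _ => ?_
    induction e using Sym2.ind with
    | _ a b =>
      refine (Finset.card_le_card (t := {(a, b), (b, a)}) fun q hq => ?_).trans
        Finset.card_le_two
      have := (Finset.mem_filter.1 hq).2
      simp only [Sym2.eq_iff] at this
      simp only [Finset.mem_insert, Finset.mem_singleton, Prod.ext_iff]
      exact this
  have h7 : (A.card : ℝ) ≤
      ∑ e ∈ allEdges n, min (deficiency G - deficiency (nextGraph G e)) 2 := by
    calc (A.card : ℝ) ≤ 2 * (A.image fun q => s(q.1, q.2)).card := by exact_mod_cast h6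
      _ = ∑ e ∈ A.image (fun q => s(q.1, q.2)), (2 : ℝ) := by simp [mul_comm]
      _ = ∑ e ∈ A.image (fun q => s(q.1, q.2)),
          min (deficiency G - deficiency (nextGraph G e)) 2 := by
        refine Finset.sum_congr rfl fun e he => ?_
        obtain ⟨q, hq, rfl⟩ := Finset.mem_image.1 he
        rw [deficiency_nextGraph hG (Finset.mem_filter.1 hq).2, min_self]
      _ ≤ _ := by
        refine Finset.sum_le_sum_of_subset_of_nonneg (fun e he => ?_) fun e _ _ => ?_
        · obtain ⟨q, hq, rfl⟩ := Finset.mem_image.1 he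
          simpa [allEdges] using (Finset.mem_filter.1 hq).2.1
        · exact le_min (sub_nonneg.2 (deficiency_anti (le_nextGraph G e))) (by norm_num)
  calc (deficiency G ^ 2 - deficiency G) ^ 2 ≤ (∑ q ∈ A, p q.1 * p q.2) ^ 2 :=
        pow_le_pow_left₀ (by nlinarith) h1 2
    _ ≤ _ := h5
    _ ≤ _ := mul_le_mul_of_nonneg_right h7 (sq_nonneg _)

/-- If `w` is missed, match it to `b` and release the former partner of `b`. -/
def reroute {n : ℕ} (w b : Fin n) (f : Fin n → Fin n) : Fin n → Fin n :=
  if f w = w then fun v => if v = w then b else if v = b then w else if v = f b then v else f v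
  else f

lemma reroute_eq_self_iff {n : ℕ} {w b : Fin n} {f : Fin n → Fin n} (hf : Function.Involutive f)
    (hw : f w = w) (hwb : w ≠ b) (v : Fin n) (hb : f b ≠ b) :
    reroute w b f v = v ↔ (f v = v ∧ v ≠ w) ∨ v = f b := by
  have h1 : f b ≠ w := fun h => hwb (by rw [← hf b, h, hw])
  unfold reroute
  rw [if_pos hw]
  grind

lemma IsInvMatching.reroute {n : ℕ} {G H : SimpleGraph (Fin n)} {f : Fin n → Fin n}
    (hf : IsInvMatching G f) (hGH : G ≤ H) {w b : Fin n} (hwb : H.Adj w b) (hw : f w = w)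
    (hb : f b ≠ b) : IsInvMatching H (reroute w b f) := by
  have hne := hwb.ne
  have h1 : f b ≠ w := fun h => hne (by rw [← hf.1 b, h, hw])
  refine ⟨fun v => ?_, fun v => ?_⟩
  · have h2 := hf.1 v
    have h3 := hf.1 b
    have h4 := fun h : f v = f b => hf.1.injective h
    unfold _root_.reroute
    simp only [if_pos hw]
    grind
  · have h2 := hf.2 v
    have h3 := hwb.symm
    unfold _root_.reroute
    simp only [if_pos hw]
    split_ifs with h4 h5 h6
    · subst h4; exact fun _ => hwb
    · subst h5; exact fun _ => h3
    · exact fun h => absurd rfl h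
    · exact fun h => hGH (h2 h)

lemma IsMaxInv.reroute {n : ℕ} {G H : SimpleGraph (Fin n)} {f : Fin n → Fin n}
    (hf : IsMaxInv G f) (hGH : G ≤ H) (hm : matchNum H = matchNum G) {w b : Fin n}
    (hwb : H.Adj w b) (hb : f b ≠ b) : IsMaxInv H (reroute w b f) := by
  by_cases hw : f w = w
  · refine ⟨hf.1.reroute hGH hwb hw hb, ?_⟩
    have h1 : fixedSet (_root_.reroute w b f) = insert (f b) ((fixedSet f).erase w) := by
      ext v
      rw [mem_fixedSet, reroute_eq_self_iff hf.1.1 hw hwb.ne v hb]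
      simp only [Finset.mem_insert, Finset.mem_erase, mem_fixedSet]
      tauto
    have h2 : f b ∉ (fixedSet f).erase w := by
      simp only [Finset.mem_erase, mem_fixedSet, hf.1.1 b]
      exact fun h => hb h.2.symm
    rw [h1, Finset.card_insert_of_notMem h2, Finset.card_erase_add_one (by simpa), hm, hf.2]
  · rw [_root_.reroute, if_neg hw]
    exact ⟨hf.1.mono hGH, by rw [hm, hf.2]⟩

/-- The probability that `w` is missed and `b` is matched to `v`. -/
def releaseProb {n : ℕ} (μ : (Fin n → Fin n) → ℝ) (w b v : Fin n) : ℝ :=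
  ∑ f, μ f * if f w = w ∧ f b = v then 1 else 0

lemma releaseProb_nonneg {n : ℕ} {μ : (Fin n → Fin n) → ℝ} (h : ∀ f, 0 ≤ μ f) (w b v : Fin n) :
    0 ≤ releaseProb μ w b v :=
  Finset.sum_nonneg fun f _ => mul_nonneg (h f) (by split_ifs <;> norm_num)

lemma sum_releaseProb {n : ℕ} (μ : (Fin n → Fin n) → ℝ) (w b : Fin n) :
    ∑ v, releaseProb μ w b v = missProb μ w := by
  unfold releaseProb missProb
  rw [Finset.sum_comm]
  refine Finset.sum_congr rfl fun f _ => ?_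
  rw [← Finset.mul_sum]
  congr 1
  by_cases h : f w = w <;> simp [h]

lemma IsDist.sum_releaseProb_left_le {n : ℕ} {G : SimpleGraph (Fin n)}
    {μ : (Fin n → Fin n) → ℝ} (hμ : IsDist G μ) (C : Finset (Fin n)) (w v : Fin n) :
    ∑ b ∈ C, releaseProb μ w b v ≤ missProb μ w := by
  refine (Finset.sum_le_univ_sum_of_nonneg fun b => releaseProb_nonneg hμ.1 w b v).trans ?_
  unfold releaseProb missProb
  rw [Finset.sum_comm]
  refine Finset.sum_le_sum fun f _ => ?_
  rw [← Finset.mul_sum]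
  by_cases hf : IsMaxInv G f
  · refine mul_le_mul_of_nonneg_left ?_ (hμ.1 f)
    have : ∀ b, f b = v ↔ f v = b := fun b => by
      constructor <;> (rintro rfl; exact hf.1.1 _)
    by_cases h : f w = w <;> simp [h, this]
  · simp [hμ.2.2 f hf]

lemma IsDist.missProb_reroute {n : ℕ} {G : SimpleGraph (Fin n)}
    {μ : (Fin n → Fin n) → ℝ} (hμ : IsDist G μ) {w b : Fin n} (hwb : w ≠ b)
    (hb : ∀ f, IsMaxInv G f → f b ≠ b) (v : Fin n) :
    missProb (pushDist (reroute w b) μ) v =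
      (if v = w then 0 else missProb μ v) + releaseProb μ w b v := by
  unfold missProb releaseProb
  rw [sum_pushDist (reroute w b) μ (fun g => if g v = v then 1 else 0)]
  have h0 : (if v = w then 0 else ∑ f, μ f * if f v = v then (1:ℝ) else 0) =
      ∑ f, μ f * if v ≠ w ∧ f v = v then (1:ℝ) else 0 := by
    split_ifs with h <;> simp [h]
  rw [h0, ← Finset.sum_add_distrib]
  refine Finset.sum_congr rfl fun f _ => ?_
  by_cases hf : IsMaxInv G f
  · rw [← mul_add]
    congr 1
    have h3 := hb f hf
    have h4 := hf.1.1 b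
    by_cases hw : f w = w
    · rw [if_congr (reroute_eq_self_iff hf.1.1 hw hwb v h3) rfl rfl]
      grind
    · rw [reroute, if_neg hw]
      grind
  · simp [hμ.2.2 f hf]

lemma IsDist.average {n : ℕ} {G : SimpleGraph (Fin n)} {μ μ' : (Fin n → Fin n) → ℝ}
    (h : IsDist G μ) (h' : IsDist G μ') : IsDist G (fun f => (μ f + μ' f) / 2) := by
  refine ⟨fun f => ?_, ?_, fun f hf => ?_⟩
  · have := h.1 f
    have := h'.1 f
    positivity
  · rw [← Finset.sum_div, Finset.sum_add_distrib, h.2.1, h'.2.1]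
    norm_num
  · simp [h.2.2 f hf, h'.2.2 f hf]

lemma missProb_average {n : ℕ} (μ μ' : (Fin n → Fin n) → ℝ) (v : Fin n) :
    missProb (fun f => (μ f + μ' f) / 2) v = (missProb μ v + missProb μ' v) / 2 := by
  unfold missProb
  rw [← Finset.sum_add_distrib, Finset.sum_div]
  exact Finset.sum_congr rfl fun f _ => by ring

lemma IsDist.minEnergy_drop {n : ℕ} {G H : SimpleGraph (Fin n)} {μ : (Fin n → Fin n) → ℝ}
    (hμ : IsDist G μ) (hGH : G ≤ H) (hm : matchNum H = matchNum G) {w b : Fin n}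
    (hwb : H.Adj w b) (hb : ∀ f, IsMaxInv G f → f b ≠ b) :
    missProb μ w ^ 2 / 2 - ∑ v, missProb μ v * releaseProb μ w b v ≤
      energy μ - minEnergy H := by
  have h1 : IsDist H (pushDist (reroute w b) μ) :=
    hμ.push fun f hf => hf.reroute hGH hm hwb (hb f hf)
  have h2 : IsDist H μ :=
    ⟨hμ.1, hμ.2.1, fun f hf => hμ.2.2 f fun hf' => hf ⟨hf'.1.mono hGH, by rw [hm, hf'.2]⟩⟩
  have h3 := minEnergy_le (h2.average h1)
  set p := missProb μ with hp
  set r := releaseProb μ w b with hr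
  have hr0 : ∀ v, 0 ≤ r v := releaseProb_nonneg hμ.1 w b
  have hrw : r w = 0 := by
    refine Finset.sum_eq_zero fun f _ => ?_
    by_cases hf : IsMaxInv G f
    · rw [if_neg, mul_zero]
      rintro ⟨h4, h5⟩
      exact hwb.ne (by rw [← hf.1.1 b, h5, h4])
    · simp [hμ.2.2 f hf]
  have h4 : energy (fun f => (μ f + pushDist (reroute w b) μ f) / 2) =
      ∑ v, (p v ^ 2 + p v * r v + r v ^ 2 / 4 - if v = w then 3 / 4 * p w ^ 2 else 0) := by
    refine Finset.sum_congr rfl fun v _ => ?_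
    rw [missProb_average, hμ.missProb_reroute hwb.ne hb v, ← hp, ← hr]
    split_ifs with h
    · subst h
      rw [hrw]
      ring
    · ring
  have h5 : ∑ v, r v ^ 2 ≤ p w ^ 2 := by
    rw [hp, ← sum_releaseProb μ w b]
    exact Finset.sum_sq_le_sq_sum_of_nonneg fun v _ => hr0 v
  have h6 : energy μ = ∑ v, p v ^ 2 := rfl
  rw [h4, Finset.sum_sub_distrib, Finset.sum_add_distrib, Finset.sum_add_distrib,
    ← Finset.sum_div, Finset.sum_ite_eq' Finset.univ w, if_pos (Finset.mem_univ w)] at h3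
  rw [h6]
  linarith

/-- Expected decrease of the energy in one step. -/
theorem sum_minEnergy_drop {n : ℕ} {G : SimpleGraph (Fin n)} (hG : IsKonig G) :
    (n - deficiency G) / 4 * minEnergy G - deficiency G ^ 2 ≤
      ∑ e ∈ allEdges n, min (minEnergy G - minEnergy (nextGraph G e)) 1 := by
  obtain ⟨μ, hμ, hopt⟩ := exists_optimal G
  obtain ⟨C, hC, hcard, hfix⟩ := hG.exists_cover
  set p := missProb μ with hp
  have hp0 : ∀ v, 0 ≤ p v := missProb_nonneg hμ.1
  have hp1 : ∀ v, p v ≤ 1 := hμ.missProb_le_one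
  have hpC : ∀ v ∈ C, p v = 0 := fun v hv => by
    refine Finset.sum_eq_zero fun f _ => ?_
    by_cases hf : IsMaxInv G f
    · simp [hfix f hf v hv]
    · simp [hμ.2.2 f hf]
  have hsum : ∑ x, p x = deficiency G := hμ.sum_missProb
  have hinj : Set.InjOn (fun q : Fin n × Fin n => s(q.1, q.2)) (Cᶜ ×ˢ C : Finset _) := by
    rintro ⟨a, b⟩ h1 ⟨c, d⟩ h2 h
    simp only [Finset.coe_product, Set.mem_prod, Finset.mem_coe, Finset.mem_compl] at h1 h2
    rcases Sym2.eq_iff.1 h with ⟨rfl, rfl⟩ | ⟨rfl, rfl⟩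
    · rfl
    · exact absurd h2.2 h1.1
  have hdrop : ∀ q ∈ (Cᶜ ×ˢ C : Finset (Fin n × Fin n)),
      p q.1 ^ 2 / 2 - ∑ v, p v * releaseProb μ q.1 q.2 v ≤
        min (minEnergy G - minEnergy (nextGraph G s(q.1, q.2))) 1 := by
    rintro ⟨w, b⟩ hq
    simp only [Finset.mem_product, Finset.mem_compl] at hq
    have hwb : w ≠ b := fun h => hq.1 (h ▸ hq.2)
    obtain ⟨h1, h2⟩ := isKonig_addEdge_of_cover hC hcard hq.2 (b := w)
    rw [Sym2.eq_swap] at h1 h2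
    refine le_min ?_ ?_
    · rw [nextGraph, if_pos h1, ← hopt]
      exact hμ.minEnergy_drop le_sup_left h2 (addEdge_adj G hwb) fun f hf => hfix f hf b hq.2
    · have h3 : 0 ≤ ∑ v, p v * releaseProb μ w b v :=
        Finset.sum_nonneg fun v _ => mul_nonneg (hp0 v) (releaseProb_nonneg hμ.1 w b v)
      have h4 := hp0 w
      have h5 := hp1 w
      dsimp only
      nlinarith
  have hcross : ∑ q ∈ (Cᶜ ×ˢ C : Finset (Fin n × Fin n)), ∑ v, p v * releaseProb μ q.1 q.2 v ≤
      deficiency G ^ 2 := by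
    rw [Finset.sum_product]
    calc ∑ w ∈ Cᶜ, ∑ b ∈ C, ∑ v, p v * releaseProb μ w b v
        = ∑ w ∈ Cᶜ, ∑ v, p v * ∑ b ∈ C, releaseProb μ w b v := by
          refine Finset.sum_congr rfl fun w _ => ?_
          rw [Finset.sum_comm]
          simp_rw [Finset.mul_sum]
      _ ≤ ∑ w ∈ Cᶜ, ∑ v, p v * p w := Finset.sum_le_sum fun w _ => Finset.sum_le_sum fun v _ =>
          mul_le_mul_of_nonneg_left (hμ.sum_releaseProb_left_le C w v) (hp0 v)
      _ ≤ ∑ w, ∑ v, p v * p w := Finset.sum_le_univ_sum_of_nonneg fun w =>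
          Finset.sum_nonneg fun v _ => mul_nonneg (hp0 v) (hp0 w)
      _ = deficiency G ^ 2 := by
          simp_rw [← Finset.sum_mul, ← Finset.mul_sum, hsum, sq]
  have hmain : ∑ q ∈ (Cᶜ ×ˢ C : Finset (Fin n × Fin n)), p q.1 ^ 2 / 2 =
      (n - deficiency G) / 4 * minEnergy G := by
    rw [Finset.sum_product]
    have h1 : ∑ w ∈ Cᶜ, p w ^ 2 = minEnergy G := by
      rw [← hopt, energy, ← Finset.sum_compl_add_sum C, ← hp]
      rw [Finset.sum_eq_zero (s := C) fun v hv => by rw [hpC v hv]; norm_num, add_zero]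
    simp only [Finset.sum_const, nsmul_eq_mul, ← Finset.mul_sum, ← Finset.sum_div, h1, hcard,
      deficiency]
    ring
  calc (n - deficiency G) / 4 * minEnergy G - deficiency G ^ 2
      ≤ ∑ q ∈ (Cᶜ ×ˢ C : Finset (Fin n × Fin n)),
        (p q.1 ^ 2 / 2 - ∑ v, p v * releaseProb μ q.1 q.2 v) := by
        rw [Finset.sum_sub_distrib, hmain]
        linarith
    _ ≤ ∑ q ∈ (Cᶜ ×ˢ C : Finset (Fin n × Fin n)),
        min (minEnergy G - minEnergy (nextGraph G s(q.1, q.2))) 1 := Finset.sum_le_sum hdrop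
    _ = ∑ e ∈ (Cᶜ ×ˢ C : Finset (Fin n × Fin n)).image (fun q => s(q.1, q.2)),
        min (minEnergy G - minEnergy (nextGraph G e)) 1 := by
        rw [Finset.sum_image hinj]
    _ ≤ _ := by
        refine Finset.sum_le_sum_of_subset_of_nonneg (fun e he => ?_) fun e _ _ => ?_
        · obtain ⟨q, hq, rfl⟩ := Finset.mem_image.1 he
          simp only [Finset.mem_product, Finset.mem_compl] at hq
          simp only [allEdges, Finset.mem_filter, Finset.mem_univ, true_and, Sym2.mk_isDiag_iff]
          exact fun h => hq.1 (h ▸ hq.2)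
        · exact le_min (sub_nonneg.2 (minEnergy_anti (le_nextGraph G e))) (by norm_num)

instance (n : ℕ) : Fintype (EdgeOrdering n) :=
  inferInstanceAs (Fintype {σ : Fin (n*(n-1)/2) → Sym2 (Fin n) //
    Function.Injective σ ∧ ∀ i, ¬ (σ i).IsDiag})

lemma card_allEdges (n : ℕ) : (allEdges n).card = n * (n - 1) / 2 := by
  rw [allEdges, ← Fintype.card_subtype, Sym2.card_subtype_not_diag, Fintype.card_fin,
    Nat.choose_two_right]

instance (n : ℕ) : Nonempty (EdgeOrdering n) := by
  have e : Fin (n*(n-1)/2) ≃ allEdges n :=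
    Fintype.equivOfCardEq (by rw [Fintype.card_fin, Fintype.card_coe, card_allEdges])
  refine ⟨⟨fun i => (e i).1, fun i j h => e.injective (Subtype.ext h), fun i => ?_⟩⟩
  exact (Finset.mem_filter.1 (e i).2).2

lemma EdgeOrdering.image_eq {n : ℕ} (σ : EdgeOrdering n) :
    Finset.univ.image σ.1 = allEdges n := by
  refine Finset.eq_of_subset_of_card_le (fun e he => ?_) ?_
  · obtain ⟨i, -, rfl⟩ := Finset.mem_image.1 he
    simpa [allEdges] using σ.2.2 i
  · rw [Finset.card_image_of_injective _ σ.2.1, card_allEdges, Finset.card_univ, Fintype.card_fin]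

lemma EdgeOrdering.sum_eq {n : ℕ} (σ : EdgeOrdering n) (d : Sym2 (Fin n) → ℝ) :
    ∑ i, d (σ.1 i) = ∑ e ∈ allEdges n, d e := by
  rw [← σ.image_eq, Finset.sum_image fun i _ j _ h => σ.2.1 h]

/-- The steps from `m` on. -/
def laterSteps (n m : ℕ) : Finset (Fin (n*(n-1)/2)) := Finset.univ.filter fun i => m ≤ i.1

lemma card_filter_lt_le {N : ℕ} (m : ℕ) :
    (Finset.univ.filter fun i : Fin N => ¬ m ≤ i.1).card ≤ m := by
  calc _ ≤ (Finset.range m).card :=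
        Finset.card_le_card_of_injOn (fun i => i.1) (fun i hi => by simpa using hi)
          (fun i _ j _ h => Fin.ext h)
    _ = m := Finset.card_range m

lemma EdgeOrdering.sum_later_ge {n : ℕ} (σ : EdgeOrdering n) (m : ℕ) (d : Sym2 (Fin n) → ℝ)
    (hd : ∀ e, d e ≤ 2) :
    ∑ e ∈ allEdges n, d e - 2 * m ≤ ∑ i ∈ laterSteps n m, d (σ.1 i) := by
  rw [← σ.sum_eq, ← Finset.sum_filter_add_sum_filter_not Finset.univ
    (fun i : Fin (n*(n-1)/2) => m ≤ i.1), laterSteps]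
  have h1 : ∑ i with ¬ m ≤ i.1, d (σ.1 i) ≤
      (Finset.univ.filter fun i : Fin (n*(n-1)/2) => ¬ m ≤ i.1).card • (2:ℝ) :=
    Finset.sum_le_card_nsmul _ _ _ fun i _ => hd _
  have h2 : ((Finset.univ.filter fun i : Fin (n*(n-1)/2) => ¬ m ≤ i.1).card : ℝ) ≤ m := by
    exact_mod_cast card_filter_lt_le m
  rw [nsmul_eq_mul] at h1
  linarith

/-- Exchange two entries of an ordering. -/
def EdgeOrdering.swapEquiv {n : ℕ} (i j : Fin (n*(n-1)/2)) : EdgeOrdering n ≃ EdgeOrdering n where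
  toFun σ := ⟨σ.1 ∘ Equiv.swap i j, σ.2.1.comp (Equiv.injective _), fun _ => σ.2.2 _⟩
  invFun σ := ⟨σ.1 ∘ Equiv.swap i j, σ.2.1.comp (Equiv.injective _), fun _ => σ.2.2 _⟩
  left_inv σ := Subtype.ext (by ext k; simp)
  right_inv σ := Subtype.ext (by ext k; simp)

lemma sum_edgeOrdering_eq {n : ℕ} {Φ : EdgeOrdering n → Sym2 (Fin n) → ℝ}
    (i : Fin (n*(n-1)/2)) (hΦ : ∀ σ τ : EdgeOrdering n, (∀ k < i, σ.1 k = τ.1 k) → Φ σ = Φ τ)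
    {j : Fin (n*(n-1)/2)} (hij : i ≤ j) :
    ∑ σ : EdgeOrdering n, Φ σ (σ.1 i) = ∑ σ : EdgeOrdering n, Φ σ (σ.1 j) := by
  rw [← Equiv.sum_comp (EdgeOrdering.swapEquiv i j)]
  refine Finset.sum_congr rfl fun σ _ => ?_
  rw [hΦ (EdgeOrdering.swapEquiv i j σ) σ fun k hk => ?_]
  · change Φ σ (σ.1 (Equiv.swap i j i)) = _
    rw [Equiv.swap_apply_left]
  · change σ.1 (Equiv.swap i j k) = _
    rw [Equiv.swap_apply_of_ne_of_ne hk.ne (hk.trans_le hij).ne]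

/-- Averaging over the next edge, which is uniform on the remaining ones. -/
theorem sum_edgeOrdering_step {n m : ℕ} (hm : m < n*(n-1)/2)
    {Ψ Ψ' : EdgeOrdering n → ℝ} {Φ : EdgeOrdering n → Sym2 (Fin n) → ℝ} {c : ℝ}
    (hΦ : ∀ σ τ : EdgeOrdering n,
      (∀ k : Fin (n*(n-1)/2), k.1 < m → σ.1 k = τ.1 k) → Φ σ = Φ τ)
    (h1 : ∀ σ, Ψ' σ ≤ Φ σ (σ.1 ⟨m, hm⟩))
    (h2 : ∀ σ, ∑ i ∈ laterSteps n m, Φ σ (σ.1 i) ≤ (laterSteps n m).card * (Ψ σ + c)) :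
    ∑ σ, Ψ' σ ≤ ∑ σ, Ψ σ + Fintype.card (EdgeOrdering n) * c := by
  have hpos : (0:ℝ) < (laterSteps n m).card := by
    have h0 : (⟨m, hm⟩ : Fin (n*(n-1)/2)) ∈ laterSteps n m := by simp [laterSteps]
    exact_mod_cast Finset.card_pos.2 ⟨_, h0⟩
  have h3 : (laterSteps n m).card * ∑ σ : EdgeOrdering n, Φ σ (σ.1 ⟨m, hm⟩) =
      ∑ σ : EdgeOrdering n, ∑ i ∈ laterSteps n m, Φ σ (σ.1 i) := by
    rw [Finset.sum_comm, ← nsmul_eq_mul, ← Finset.sum_const]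
    refine Finset.sum_congr rfl fun i hi => ?_
    exact sum_edgeOrdering_eq ⟨m, hm⟩ (fun σ τ h => hΦ σ τ fun k hk => h k hk)
      (Finset.mem_filter.1 hi).2
  have h4 : (laterSteps n m).card * ∑ σ : EdgeOrdering n, Φ σ (σ.1 ⟨m, hm⟩) ≤
      (laterSteps n m).card * (∑ σ, Ψ σ + Fintype.card (EdgeOrdering n) * c) := by
    rw [h3]
    refine (Finset.sum_le_sum fun σ _ => h2 σ).trans_eq ?_
    rw [← Finset.mul_sum, Finset.sum_add_distrib, Finset.sum_const, nsmul_eq_mul, Finset.card_univ]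
  exact (Finset.sum_le_sum fun σ _ => h1 σ).trans (le_of_mul_le_mul_left h4 hpos)

lemma konigProc_succ {n m : ℕ} (σ : EdgeOrdering n) (hm : m < n*(n-1)/2) :
    KonigProc σ (m + 1) = nextGraph (KonigProc σ m) (σ.1 ⟨m, hm⟩) := by
  rw [KonigProc, dif_pos hm]
  rfl

lemma matchNum_bot (n : ℕ) : matchNum (⊥ : SimpleGraph (Fin n)) = 0 := by
  obtain ⟨f, hf, h⟩ := exists_isMaxInv (⊥ : SimpleGraph (Fin n))
  have : fixedSet f = Finset.univ := by
    ext v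
    simp only [mem_fixedSet, Finset.mem_univ, iff_true]
    by_contra hv
    simpa using hf.2 v hv
  rw [this, Finset.card_univ, Fintype.card_fin] at h
  omega

lemma isKonig_konigProc {n : ℕ} (σ : EdgeOrdering n) (m : ℕ) : IsKonig (KonigProc σ m) := by
  induction m with
  | zero =>
    have h1 : coverNum (⊥ : SimpleGraph (Fin n)) ≤ 0 :=
      coverNum_le (C := ∅) fun e he => by simp at he
    change matchNum ⊥ = coverNum ⊥
    rw [matchNum_bot]
    omega
  | succ m ih =>
    by_cases hm : m < n*(n-1)/2
    · rw [konigProc_succ σ hm, nextGraph]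
      split_ifs with h
      exacts [h, ih]
    · rwa [KonigProc, dif_neg hm]

lemma konigProc_congr {n : ℕ} {σ τ : EdgeOrdering n} {m : ℕ}
    (h : ∀ k : Fin (n*(n-1)/2), k.1 < m → σ.1 k = τ.1 k) : KonigProc σ m = KonigProc τ m := by
  induction m with
  | zero => rfl
  | succ m ih =>
    have ih' := ih fun k hk => h k (hk.trans (Nat.lt_succ_self m))
    by_cases hm : m < n*(n-1)/2
    · rw [konigProc_succ σ hm, konigProc_succ τ hm, ih', h ⟨m, hm⟩ (Nat.lt_succ_self m)]
    · rw [KonigProc, KonigProc, dif_neg hm, dif_neg hm, ih']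

lemma exp_neg_le_of_small {x : ℝ} (h0 : 0 ≤ x) (h1 : x ≤ 0.02) :
    Real.exp (-x) ≤ 1 - 0.98 * x := by
  have h2 := Real.abs_exp_sub_one_sub_id_le (x := -x) (by rw [abs_neg, abs_of_nonneg h0]; linarith)
  have h3 := (abs_le.1 h2).2
  nlinarith

/-- If a nonnegative quantity `v` drops on average by a factor `exp (-θ)` whenever it is at least
half of its target `u`, then its exponential moment relative to the moving target hardly grows. -/
lemma sum_exp_drift {ι : Type*} (J : Finset ι) {val d : ι → ℝ} {v u u' θ l : ℝ}
    (hval : ∀ i ∈ J, val i ≤ v - d i) (hd0 : ∀ i ∈ J, 0 ≤ d i) (hd2 : ∀ i ∈ J, d i ≤ 2)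
    (hv : 0 ≤ v) (hu : 0 < u) (hu' : u' = u * Real.exp (-θ)) (hθ : Real.exp θ ≤ 1.2)
    (hl : 0 < l) (hlu : l ≤ 0.01 * u')
    (h : u / 2 ≤ v → J.card * (v * θ) ≤ 0.98 * ∑ i ∈ J, d i) :
    ∑ i ∈ J, Real.exp (l * val i / u') ≤
      J.card * (Real.exp (l * v / u) + Real.exp (0.6 * l)) := by
  have hu'0 : 0 < u' := by rw [hu']; positivity
  by_cases hcase : u / 2 ≤ v
  · have h1 : ∀ i ∈ J, Real.exp (l * val i / u') ≤
        Real.exp (l * v / u') * (1 - 0.98 * (l / u' * d i)) := fun i hi => by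
      have h2 : l * val i / u' ≤ l * v / u' + -(l / u' * d i) := by
        rw [div_mul_eq_mul_div, ← neg_div, ← add_div]
        refine div_le_div_of_nonneg_right ?_ hu'0.le
        nlinarith [hval i hi]
      refine (Real.exp_le_exp.2 h2).trans ?_
      rw [Real.exp_add]
      refine mul_le_mul_of_nonneg_left (exp_neg_le_of_small ?_ ?_) (Real.exp_pos _).le
      · exact mul_nonneg (by positivity) (hd0 i hi)
      · have h3 : l / u' ≤ 0.01 := by rwa [div_le_iff₀ hu'0]
        have h4 : 0 < l / u' := by positivity
        nlinarith [hd0 i hi, hd2 i hi]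
    have h5 : ∑ i ∈ J, Real.exp (l * val i / u') ≤
        J.card * (Real.exp (l * v / u') * (1 - l / u' * (v * θ))) := by
      refine (Finset.sum_le_sum h1).trans ?_
      rw [← Finset.mul_sum, Finset.sum_sub_distrib, ← Finset.mul_sum, ← Finset.mul_sum,
        Finset.sum_const, nsmul_eq_mul, mul_one, mul_left_comm (J.card : ℝ)]
      refine mul_le_mul_of_nonneg_left ?_ (Real.exp_pos _).le
      have h4 : 0 < l / u' := by positivity
      nlinarith [mul_le_mul_of_nonneg_left (h hcase) h4.le]
    refine h5.trans (mul_le_mul_of_nonneg_left ?_ (by positivity))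
    have h6 : Real.exp (l * v / u') * (1 - l / u' * (v * θ)) ≤ Real.exp (l * v / u) := by
      have h7 : 1 - l / u' * (v * θ) ≤ Real.exp (-(l / u' * (v * θ))) := by
        linarith [Real.add_one_le_exp (-(l / u' * (v * θ)))]
      refine (mul_le_mul_of_nonneg_left h7 (Real.exp_pos _).le).trans ?_
      rw [← Real.exp_add]
      refine Real.exp_le_exp.2 ?_
      have h8 : l * v / u = l / u' * v * Real.exp (-θ) := by
        rw [hu']
        field_simp
      rw [h8]
      have h9 := Real.add_one_le_exp (-θ)
      have h10 : 0 ≤ l / u' * v := by positivity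
      have h11 : l * v / u' = l / u' * v := by ring
      nlinarith
    have := Real.exp_pos (0.6 * l)
    linarith
  · rw [← nsmul_eq_mul]
    refine Finset.sum_le_card_nsmul _ _ _ fun i hi => ?_
    have h1 : Real.exp (l * val i / u') ≤ Real.exp (0.6 * l) := by
      refine Real.exp_le_exp.2 ?_
      rw [div_le_iff₀ hu'0]
      have h2 : u = u' * Real.exp θ := by rw [hu', mul_assoc, ← Real.exp_add]; simp
      have h3 : u ≤ 1.2 * u' := by rw [h2]; nlinarith
      have h4 := hval i hi
      have h5 := hd0 i hi
      have h6 : val i ≤ 0.6 * u' := by linarith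
      nlinarith
    have := Real.exp_pos (l * v / u)
    linarith

lemma card_laterSteps_le (n m : ℕ) : ((laterSteps n m).card : ℝ) ≤ n ^ 2 / 2 := by
  have h1 : (laterSteps n m).card ≤ n * (n - 1) / 2 := by
    simpa using Finset.card_le_univ (laterSteps n m)
  have h2 : 2 * (n * (n - 1) / 2) ≤ n * n :=
    (Nat.mul_div_le _ _).trans (Nat.mul_le_mul_left _ (Nat.sub_le _ _))
  have h3 : (2 * (laterSteps n m).card : ℝ) ≤ n * n := by exact_mod_cast (by omega)
  nlinarith

lemma deficiency_step {n m : ℕ} (σ : EdgeOrdering n) {G : SimpleGraph (Fin n)} (hG : IsKonig G)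
    {u u' α l : ℝ} (hn : 0 < n) (hu : 0 < u) (hu' : u' = u * Real.exp (-(α / n))) (hα0 : 0 ≤ α)
    (hα : Real.exp (α / n) ≤ 1.2) (hl : 0 < l) (hlu : l ≤ 0.01 * u')
    (h : α ≠ 0 → u / 2 ≤ deficiency G → 1 < deficiency G ∧
      (deficiency G * α * n / 1.96 + 2 * m) * minEnergy G ^ 2 ≤
        (deficiency G ^ 2 - deficiency G) ^ 2) :
    ∑ i ∈ laterSteps n m, Real.exp (l * deficiency (nextGraph G (σ.1 i)) / u') ≤
      (laterSteps n m).card * (Real.exp (l * deficiency G / u) + Real.exp (0.6 * l)) := by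
  set d : Sym2 (Fin n) → ℝ := fun e => min (deficiency G - deficiency (nextGraph G e)) 2 with hd
  have hd0 : ∀ e, 0 ≤ d e := fun e =>
    le_min (sub_nonneg.2 (deficiency_anti (le_nextGraph G e))) (by norm_num)
  have hd2 : ∀ e, d e ≤ 2 := fun e => min_le_right _ _
  refine sum_exp_drift (laterSteps n m) (d := fun i => d (σ.1 i))
    (fun i _ => by linarith [min_le_left (deficiency G - deficiency (nextGraph G (σ.1 i))) 2])
    (fun i _ => hd0 _) (fun i _ => hd2 _) (deficiency_nonneg G) hu hu' hα hl hlu fun hU => ?_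
  rcases eq_or_ne α 0 with h0 | h0
  · rw [h0, zero_div, mul_zero, mul_zero]
    exact mul_nonneg (by norm_num) (Finset.sum_nonneg fun i _ => hd0 _)
  obtain ⟨h1, h2⟩ := h h0 hU
  have h3 := sum_deficiency_drop hG h1.le
  have hR : 0 < minEnergy G ^ 2 := by
    refine (sq_nonneg _).lt_of_ne fun h0 => ?_
    rw [← h0, mul_zero] at h3
    have : 0 < deficiency G ^ 2 - deficiency G := by nlinarith
    nlinarith [sq_pos_of_pos this]
  have h4 := le_of_mul_le_mul_right (h2.trans h3) hR
  have h5 := σ.sum_later_ge m d hd2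
  have h6 : ((laterSteps n m).card : ℝ) * (deficiency G * (α / n)) ≤
      n ^ 2 / 2 * (deficiency G * (α / n)) :=
    mul_le_mul_of_nonneg_right (card_laterSteps_le n m)
      (mul_nonneg (deficiency_nonneg G) (by positivity))
  have h7 : (n:ℝ) ^ 2 / 2 * (deficiency G * (α / n)) = 0.98 * (deficiency G * α * n / 1.96) := by
    have : (n:ℝ) ≠ 0 := by positivity
    field_simp
    norm_num
  rw [h7] at h6
  linarith

lemma minEnergy_step {n m : ℕ} (σ : EdgeOrdering n) {G : SimpleGraph (Fin n)} (hG : IsKonig G)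
    {u u' α l : ℝ} (hn : 0 < n) (hu : 0 < u) (hu' : u' = u * Real.exp (-(α / n))) (hα0 : 0 ≤ α)
    (hα : Real.exp (α / n) ≤ 1.2) (hl : 0 < l) (hlu : l ≤ 0.01 * u')
    (h : α ≠ 0 → u / 2 ≤ minEnergy G → minEnergy G * α * n / 1.96 + 2 * m ≤
        (n - deficiency G) / 4 * minEnergy G - deficiency G ^ 2) :
    ∑ i ∈ laterSteps n m, Real.exp (l * minEnergy (nextGraph G (σ.1 i)) / u') ≤
      (laterSteps n m).card * (Real.exp (l * minEnergy G / u) + Real.exp (0.6 * l)) := by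
  set d : Sym2 (Fin n) → ℝ := fun e => min (minEnergy G - minEnergy (nextGraph G e)) 1 with hd
  have hd0 : ∀ e, 0 ≤ d e := fun e =>
    le_min (sub_nonneg.2 (minEnergy_anti (le_nextGraph G e))) (by norm_num)
  have hd2 : ∀ e, d e ≤ 2 := fun e => (min_le_right _ _).trans (by norm_num)
  refine sum_exp_drift (laterSteps n m) (d := fun i => d (σ.1 i))
    (fun i _ => by linarith [min_le_left (minEnergy G - minEnergy (nextGraph G (σ.1 i))) 1])
    (fun i _ => hd0 _) (fun i _ => hd2 _) (minEnergy_nonneg G) hu hu' hα hl hlu fun hU => ?_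
  rcases eq_or_ne α 0 with h0 | h0
  · rw [h0, zero_div, mul_zero, mul_zero]
    exact mul_nonneg (by norm_num) (Finset.sum_nonneg fun i _ => hd0 _)
  have h4 := (h h0 hU).trans (sum_minEnergy_drop hG)
  have h5 := σ.sum_later_ge m d hd2
  have h6 : ((laterSteps n m).card : ℝ) * (minEnergy G * (α / n)) ≤
      n ^ 2 / 2 * (minEnergy G * (α / n)) :=
    mul_le_mul_of_nonneg_right (card_laterSteps_le n m)
      (mul_nonneg (minEnergy_nonneg G) (by positivity))
  have h7 : (n:ℝ) ^ 2 / 2 * (minEnergy G * (α / n)) = 0.98 * (minEnergy G * α * n / 1.96) := by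
    have : (n:ℝ) ≠ 0 := by positivity
    field_simp
    norm_num
    ring
  rw [h7] at h6
  linarith

/-- Up to time `m`, deficiency and energy stay below `u` and `ρ`. -/
def OnTrack {n : ℕ} (u ρ : ℕ → ℝ) (σ : EdgeOrdering n) (m : ℕ) : Prop :=
  ∀ i ≤ m, deficiency (KonigProc σ i) ≤ u i ∧ minEnergy (KonigProc σ i) ≤ ρ i

/-- The sum of the exponential moments of deficiency and energy relative to `u` and `ρ`. -/
def expPotential {n : ℕ} (l u ρ : ℝ) (G : SimpleGraph (Fin n)) : ℝ :=
  Real.exp (l * deficiency G / u) + Real.exp (l * minEnergy G / ρ)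

lemma exp_le_expPotential {n : ℕ} {l u ρ : ℝ} (hl : 0 < l) (hu : 0 < u) (hρ : 0 < ρ)
    {G : SimpleGraph (Fin n)} (h : ¬ (deficiency G ≤ u ∧ minEnergy G ≤ ρ)) :
    Real.exp l ≤ expPotential l u ρ G := by
  unfold expPotential
  have h1 := Real.exp_pos (l * deficiency G / u)
  have h2 := Real.exp_pos (l * minEnergy G / ρ)
  rw [not_and_or, not_le, not_le] at h
  rcases h with h | h
  · have : l ≤ l * deficiency G / u := by rw [le_div_iff₀ hu]; nlinarith
    linarith [Real.exp_le_exp.2 this]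
  · have : l ≤ l * minEnergy G / ρ := by rw [le_div_iff₀ hρ]; nlinarith
    linarith [Real.exp_le_exp.2 this]

/-- The potential stopped when the process leaves the track. -/
def stoppedPotential {n : ℕ} (l : ℝ) (u ρ : ℕ → ℝ) (m : ℕ) (σ : EdgeOrdering n) : ℝ :=
  if OnTrack u ρ σ m then expPotential l (u m) (ρ m) (KonigProc σ m) else Real.exp l

theorem sum_stoppedPotential_le {n M : ℕ} (hn : 0 < n) (hM : M ≤ n*(n-1)/2)
    {u ρ α r : ℕ → ℝ} {l : ℝ} (hl : 0 < l) (hu0 : u 0 = 2 * n) (hρ0 : ρ 0 = 2 * n)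
    (hupos : ∀ j, 0 < u j) (hρpos : ∀ j, 0 < ρ j) (hα0 : ∀ j, 0 ≤ α j) (hr0 : ∀ j, 0 ≤ r j)
    (hu : ∀ j < M, u (j + 1) = u j * Real.exp (-(α j / n)))
    (hρ : ∀ j < M, ρ (j + 1) = ρ j * Real.exp (-(r j / n)))
    (hα : ∀ j < M, Real.exp (α j / n) ≤ 1.2) (hr : ∀ j < M, Real.exp (r j / n) ≤ 1.2)
    (hlu : ∀ j < M, l ≤ 0.01 * u (j + 1)) (hlρ : ∀ j < M, l ≤ 0.01 * ρ (j + 1))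
    (hU : ∀ j < M, α j ≠ 0 → ∀ U R : ℝ, u j / 2 ≤ U → U ≤ u j → 0 ≤ R → R ≤ ρ j →
      1 < U ∧ (U * α j * n / 1.96 + 2 * j) * R ^ 2 ≤ (U ^ 2 - U) ^ 2)
    (hR : ∀ j < M, r j ≠ 0 → ∀ U R : ℝ, 0 ≤ U → U ≤ u j → ρ j / 2 ≤ R → R ≤ ρ j →
      R * r j * n / 1.96 + 2 * j ≤ (n - U) / 4 * R - U ^ 2) (m : ℕ) (hm : m ≤ M) :
    ∑ σ : EdgeOrdering n, stoppedPotential l u ρ m σ ≤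
      Fintype.card (EdgeOrdering n) * (2 * Real.exp (l / 2) + m * (2 * Real.exp (0.6 * l))) := by
  induction m with
  | zero =>
    have h1 : ∀ σ : EdgeOrdering n, stoppedPotential l u ρ 0 σ ≤ 2 * Real.exp (l / 2) := fun σ => by
      have hn' : (0:ℝ) < n := by exact_mod_cast hn
      have h2 := deficiency_le (KonigProc σ 0)
      have h3 := minEnergy_le_deficiency (KonigProc σ 0)
      have h4 : OnTrack u ρ σ 0 := fun i hi => by
        obtain rfl : i = 0 := by omega
        rw [hu0, hρ0]
        constructor <;> linarith
      rw [stoppedPotential, if_pos h4, expPotential, hu0, hρ0, two_mul (Real.exp _)]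
      refine add_le_add (Real.exp_le_exp.2 ?_) (Real.exp_le_exp.2 ?_) <;>
      · rw [div_le_iff₀ (by positivity)]
        nlinarith
    refine (Finset.sum_le_sum fun σ _ => h1 σ).trans_eq ?_
    simp [Finset.card_univ]
  | succ m ih =>
    have hmM : m < M := hm
    have hmN : m < n*(n-1)/2 := hmM.trans_le hM
    have hstep := sum_edgeOrdering_step hmN (Ψ := stoppedPotential l u ρ m)
      (Ψ' := stoppedPotential l u ρ (m + 1)) (c := 2 * Real.exp (0.6 * l))
      (Φ := fun σ e => if OnTrack u ρ σ m then
        expPotential l (u (m + 1)) (ρ (m + 1)) (nextGraph (KonigProc σ m) e) else Real.exp l)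
      (fun σ τ h => by
        have h1 : ∀ i ≤ m, KonigProc σ i = KonigProc τ i := fun i hi =>
          konigProc_congr fun k hk => h k (hk.trans_le hi)
        have h2 : OnTrack u ρ σ m ↔ OnTrack u ρ τ m :=
          forall₂_congr fun i hi => by rw [h1 i hi]
        funext e
        simp only [h2, h1 m le_rfl])
      (fun σ => by
        simp only [← konigProc_succ σ hmN, stoppedPotential]
        by_cases h1 : OnTrack u ρ σ m
        · rw [if_pos h1]
          split_ifs with h2
          · exact le_rfl
          · refine exp_le_expPotential hl (hupos _) (hρpos _) fun h3 => h2 fun i hi => ?_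
            rcases Nat.le_succ_iff.1 hi with hi | rfl
            exacts [h1 i hi, h3]
        · rw [if_neg h1, if_neg fun h2 => h1 fun i hi => h2 i (hi.trans (Nat.le_succ m))])
      (fun σ => by
        simp only [stoppedPotential]
        by_cases h1 : OnTrack u ρ σ m
        · simp only [if_pos h1, expPotential]
          obtain ⟨h2, h3⟩ := h1 m le_rfl
          have hG := isKonig_konigProc σ m
          have h4 := deficiency_step σ hG (m := m) hn (hupos m) (hu m hmM) (hα0 m) (hα m hmM) hl
            (hlu m hmM) fun h0 h5 => hU m hmM h0 _ _ h5 h2 (minEnergy_nonneg _) h3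
          have h6 := minEnergy_step σ hG (m := m) hn (hρpos m) (hρ m hmM) (hr0 m) (hr m hmM) hl
            (hlρ m hmM) fun h0 h5 => hR m hmM h0 _ _ (deficiency_nonneg _) h2 h5 h3
          rw [Finset.sum_add_distrib]
          linarith
        · simp only [if_neg h1, Finset.sum_const, nsmul_eq_mul]
          have := Real.exp_pos (0.6 * l)
          exact mul_le_mul_of_nonneg_left (by linarith) (by positivity))
    have ih' := ih hmM.le
    push_cast
    linarith

theorem Pr_ge_of_sum_le {n : ℕ} {A : EdgeOrdering n → Prop} {Ψ : EdgeOrdering n → ℝ} {B c : ℝ}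
    (hB : 0 < B) (h0 : ∀ σ, 0 ≤ Ψ σ) (h1 : ∀ σ, ¬ A σ → B ≤ Ψ σ)
    (h : ∑ σ, Ψ σ ≤ Fintype.card (EdgeOrdering n) * c) : 1 - c / B ≤ Pr n A := by
  have hcard : (0:ℝ) < Fintype.card (EdgeOrdering n) := by exact_mod_cast Fintype.card_pos
  have h2 : ((Finset.univ.filter fun σ => ¬ A σ).card : ℝ) * B ≤ ∑ σ, Ψ σ := by
    rw [← nsmul_eq_mul, ← Finset.sum_const]
    exact (Finset.sum_le_sum fun σ hσ => h1 σ (Finset.mem_filter.1 hσ).2).trans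
      (Finset.sum_le_sum_of_subset_of_nonneg (Finset.filter_subset _ _) fun σ _ _ => h0 σ)
  have h3 : ((Finset.univ.filter A).card : ℝ) + (Finset.univ.filter fun σ => ¬ A σ).card =
      Fintype.card (EdgeOrdering n) := by
    exact_mod_cast Finset.card_filter_add_card_filter_not (s := Finset.univ) A
  rw [Pr, Nat.card_eq_fintype_card, Nat.card_eq_fintype_card, Fintype.card_subtype,
    le_div_iff₀ hcard]
  have h4 : ((Finset.univ.filter fun σ => ¬ A σ).card : ℝ) ≤
      Fintype.card (EdgeOrdering n) * c / B := by
    rw [le_div_iff₀ hB]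
    linarith
  have h5 : (1 - c / B) * Fintype.card (EdgeOrdering n) = Fintype.card (EdgeOrdering n) -
      Fintype.card (EdgeOrdering n) * c / B := by ring
  rw [h5]
  linarith

/-- Minus the logarithm of the (normalized) bound for the deficiency after `j` steps. -/
def defExponent (n j : ℕ) : ℝ :=
  (2 / 10 ^ 30 * (min j (10 ^ 31 * n) : ℕ) + 0.31 * (j - (10 ^ 31 + 70) * n : ℕ)) / n

/-- Minus the logarithm of the (normalized) bound for the energy after `j` steps. -/
def energyExponent (n j : ℕ) : ℝ := 0.47 * (j - 10 ^ 31 * n : ℕ) / n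

/-- The rate at which `defExponent` grows. -/
def defRate (n j : ℕ) : ℝ :=
  if j < 10 ^ 31 * n then 2 / 10 ^ 30 else if j < (10 ^ 31 + 70) * n then 0 else 0.31

/-- The rate at which `energyExponent` grows. -/
def energyRate (n j : ℕ) : ℝ := if j < 10 ^ 31 * n then 0 else 0.47

lemma defExponent_succ (n j : ℕ) : defExponent n (j + 1) = defExponent n j + defRate n j / n := by
  unfold defExponent defRate
  rw [← add_div]
  congr 1
  split_ifs with h1 h2
  · rw [min_eq_left (by omega), min_eq_left h1.le, Nat.sub_eq_zero_of_le (by omega),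
      Nat.sub_eq_zero_of_le (by omega)]
    push_cast
    ring
  · rw [min_eq_right (by omega), min_eq_right (by omega), Nat.sub_eq_zero_of_le (by omega),
      Nat.sub_eq_zero_of_le (by omega)]
    ring
  · rw [min_eq_right (by omega), min_eq_right (by omega), Nat.succ_sub (by omega)]
    push_cast
    ring

lemma energyExponent_succ (n j : ℕ) :
    energyExponent n (j + 1) = energyExponent n j + energyRate n j / n := by
  unfold energyExponent energyRate
  rw [← add_div]
  congr 1
  split_ifs with h1
  · rw [Nat.sub_eq_zero_of_le (by omega), Nat.sub_eq_zero_of_le (by omega)]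
    simp
  · rw [Nat.succ_sub (by omega)]
    push_cast
    ring

lemma defExponent_of_lt {n j : ℕ} (hn : 0 < n) (h : j < 10 ^ 31 * n) : defExponent n j ≤ 20 := by
  have hn' : (0:ℝ) < n := by exact_mod_cast hn
  have h' : (j:ℝ) < 10 ^ 31 * n := by exact_mod_cast h
  rw [defExponent, min_eq_left h.le, Nat.sub_eq_zero_of_le (by omega), div_le_iff₀ hn']
  push_cast
  linarith

lemma defExponent_of_mid {n j : ℕ} (hn : 0 < n) (h : 10 ^ 31 * n ≤ j)
    (h' : j ≤ (10 ^ 31 + 70) * n) : defExponent n j = 20 := by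
  have hn' : (0:ℝ) < n := by exact_mod_cast hn
  rw [defExponent, min_eq_right h, Nat.sub_eq_zero_of_le h', div_eq_iff hn'.ne']
  push_cast
  ring

lemma defExponent_of_ge {n j : ℕ} (hn : 0 < n) (h : (10 ^ 31 + 70) * n ≤ j) :
    defExponent n j = 20 + 0.31 * (j / n - (10 ^ 31 + 70)) := by
  have hn' : (0:ℝ) < n := by exact_mod_cast hn
  rw [defExponent, min_eq_right (by omega), Nat.cast_sub h]
  push_cast
  field_simp
  ring

lemma energyExponent_of_lt {n j : ℕ} (h : j < 10 ^ 31 * n) : energyExponent n j = 0 := by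
  rw [energyExponent, Nat.sub_eq_zero_of_le h.le]
  simp

lemma energyExponent_of_ge {n j : ℕ} (hn : 0 < n) (h : 10 ^ 31 * n ≤ j) :
    energyExponent n j = 0.47 * (j / n - 10 ^ 31) := by
  have hn' : (0:ℝ) < n := by exact_mod_cast hn
  rw [energyExponent, Nat.cast_sub h]
  push_cast
  field_simp
  ring

lemma defExponent_le {n j : ℕ} (hn : 0 < n) : defExponent n j ≤ 20 + 0.31 * (j / n) := by
  have h0 : (0:ℝ) ≤ (j:ℝ) / n := by positivity
  rcases lt_or_ge j (10 ^ 31 * n) with h | h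
  · linarith [defExponent_of_lt hn h]
  rcases le_or_gt j ((10 ^ 31 + 70) * n) with h' | h'
  · linarith [defExponent_of_mid hn h h']
  · linarith [defExponent_of_ge hn h'.le]

lemma energyExponent_le {n j : ℕ} (hn : 0 < n) : energyExponent n j ≤ 0.47 * (j / n) := by
  have h0 : (0:ℝ) ≤ (j:ℝ) / n := by positivity
  rcases lt_or_ge j (10 ^ 31 * n) with h | h
  · linarith [energyExponent_of_lt h]
  · linarith [energyExponent_of_ge hn h]

lemma energyExponent_sub_le {n j : ℕ} (hn : 0 < n) (h : 10 ^ 31 * n ≤ j) :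
    20 ≤ defExponent n j ∧ energyExponent n j - 2 * defExponent n j ≤ -7 := by
  have hn' : (0:ℝ) < n := by exact_mod_cast hn
  rw [energyExponent_of_ge hn h]
  rcases le_or_gt j ((10 ^ 31 + 70) * n) with h' | h'
  · rw [defExponent_of_mid hn h h']
    have : (j:ℝ) / n ≤ 10 ^ 31 + 70 := by
      rw [div_le_iff₀ hn']
      exact_mod_cast h'
    constructor <;> linarith
  · rw [defExponent_of_ge hn h'.le]
    have : (10 ^ 31 + 70 : ℝ) ≤ (j:ℝ) / n := by
      rw [le_div_iff₀ hn']
      exact_mod_cast h'.le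
    constructor <;> linarith

lemma energyExponent_sub_ge {n j : ℕ} (hn : 0 < n) (h : (10 ^ 31 + 70) * n ≤ j) :
    0 ≤ 2 * energyExponent n j - 3 * defExponent n j := by
  have hn' : (0:ℝ) < n := by exact_mod_cast hn
  rw [energyExponent_of_ge hn (by omega), defExponent_of_ge hn h]
  have : (10 ^ 31 + 70 : ℝ) ≤ (j:ℝ) / n := by
    rw [le_div_iff₀ hn']
    exact_mod_cast h
  linarith

/-- The drift condition for the deficiency. -/
lemma deficiency_drift {n U R A P α δ s : ℝ} (hn : 0 < n) (hU : n * Real.exp (-A) ≤ U)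
    (hU' : 200 ≤ U) (hR0 : 0 ≤ R) (hR : R ≤ 2 * n * Real.exp (-P))
    (hδ : α / 1.96 + δ ≤ 0.2475 * Real.exp (2 * P - 3 * A)) (hs : 2 * s ≤ δ * (U * n)) :
    1 < U ∧ (U * α * n / 1.96 + 2 * s) * R ^ 2 ≤ (U ^ 2 - U) ^ 2 := by
  refine ⟨by linarith, ?_⟩
  have hU0 : 0 < U := by linarith
  have h1 : R ^ 2 ≤ 4 * n ^ 2 * Real.exp (-(2 * P)) := by
    calc R ^ 2 ≤ (2 * n * Real.exp (-P)) ^ 2 := pow_le_pow_left₀ hR0 hR 2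
      _ = 4 * n ^ 2 * (Real.exp (-P) * Real.exp (-P)) := by ring
      _ = _ := by rw [← Real.exp_add]; congr 2; ring
  have h2 : n ^ 3 * Real.exp (-(3 * A)) ≤ U ^ 3 := by
    calc n ^ 3 * Real.exp (-(3 * A)) = (n * Real.exp (-A)) ^ 3 := by
          rw [mul_pow, ← Real.exp_nat_mul]
          congr 2
          push_cast
          ring
      _ ≤ U ^ 3 := pow_le_pow_left₀ (by positivity) hU 3
  have h3 : R ^ 2 * (n * Real.exp (2 * P - 3 * A)) ≤ 4 * U ^ 3 := by
    calc R ^ 2 * (n * Real.exp (2 * P - 3 * A))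
        ≤ 4 * n ^ 2 * Real.exp (-(2 * P)) * (n * Real.exp (2 * P - 3 * A)) :=
          mul_le_mul_of_nonneg_right h1 (by positivity)
      _ = 4 * (n ^ 3 * (Real.exp (-(2 * P)) * Real.exp (2 * P - 3 * A))) := by ring
      _ = 4 * (n ^ 3 * Real.exp (-(3 * A))) := by rw [← Real.exp_add]; congr 3; ring
      _ ≤ _ := by linarith
  calc (U * α * n / 1.96 + 2 * s) * R ^ 2
      ≤ (U * α * n / 1.96 + δ * (U * n)) * R ^ 2 :=
        mul_le_mul_of_nonneg_right (by linarith) (sq_nonneg R)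
    _ = (α / 1.96 + δ) * (U * n * R ^ 2) := by ring
    _ ≤ 0.2475 * Real.exp (2 * P - 3 * A) * (U * n * R ^ 2) :=
        mul_le_mul_of_nonneg_right hδ (by positivity)
    _ = 0.2475 * U * (R ^ 2 * (n * Real.exp (2 * P - 3 * A))) := by ring
    _ ≤ 0.2475 * U * (4 * U ^ 3) := mul_le_mul_of_nonneg_left h3 (by positivity)
    _ = U ^ 2 * (0.99 * U ^ 2) := by ring
    _ ≤ U ^ 2 * (U - 1) ^ 2 := mul_le_mul_of_nonneg_left (by nlinarith) (sq_nonneg U)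
    _ = _ := by ring

/-- The drift condition for the energy. -/
lemma minEnergy_drift {n U R A P s : ℝ} (hn : 0 < n) (hU0 : 0 ≤ U)
    (hU : U ≤ 2 * n * Real.exp (-A)) (hR : n * Real.exp (-P) ≤ R)
    (hA : 20 ≤ A) (hPA : P - 2 * A ≤ -7) (hs : 2 * s ≤ 0.004 * (R * n)) :
    R * 0.47 * n / 1.96 + 2 * s ≤ (n - U) / 4 * R - U ^ 2 := by
  have hR0 : 0 < R := lt_of_lt_of_le (by positivity) hR
  have e1 : (2.7:ℝ) ≤ Real.exp 1 := by linarith [Real.exp_one_gt_d9]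
  have e7 : Real.exp (-7) ≤ 0.001 := by
    rw [Real.exp_neg, inv_le_comm₀ (Real.exp_pos _) (by norm_num)]
    calc (0.001:ℝ)⁻¹ ≤ 2.7 ^ 7 := by norm_num
      _ ≤ Real.exp 1 ^ 7 := pow_le_pow_left₀ (by norm_num) e1 7
      _ = Real.exp 7 := by rw [← Real.exp_nat_mul]; norm_num
  have h1 : U ≤ 0.002 * n := by
    have : Real.exp (-A) ≤ 0.001 := (Real.exp_le_exp.2 (by linarith)).trans e7
    nlinarith
  have h2 : U ^ 2 ≤ 0.004 * (R * n) := by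
    calc U ^ 2 ≤ (2 * n * Real.exp (-A)) ^ 2 := pow_le_pow_left₀ hU0 hU 2
      _ = 4 * n * (n * (Real.exp (-A) * Real.exp (-A))) := by ring
      _ = 4 * n * (n * Real.exp (-P) * Real.exp (P - 2 * A)) := by
          rw [← Real.exp_add, mul_assoc n, ← Real.exp_add]
          congr 3
          ring
      _ ≤ 4 * n * (R * 0.001) := by
          refine mul_le_mul_of_nonneg_left ?_ (by positivity)
          exact mul_le_mul hR ((Real.exp_le_exp.2 hPA).trans e7) (Real.exp_pos _).le hR0.le
      _ = _ := by ring
  have h3 : 0 < R * n := by positivity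
  have h4 : U * R ≤ 0.002 * (R * n) := by nlinarith
  have h5 : R * 0.47 * n / 1.96 ≤ 0.24 * (R * n) := by
    rw [div_le_iff₀ (by norm_num)]
    nlinarith
  have h6 : (n - U) / 4 * R = (R * n - U * R) / 4 := by ring
  rw [h6]
  linarith

lemma inv_three_pow_le_exp_neg_sixty : (1:ℝ) / 3 ^ 60 ≤ Real.exp (-60) := by
  have e1 : Real.exp 1 ≤ 3 := by linarith [Real.exp_one_lt_d9]
  rw [Real.exp_neg, ← one_div]
  refine one_div_le_one_div_of_le (Real.exp_pos _) ?_
  calc Real.exp 60 = Real.exp 1 ^ 60 := by rw [← Real.exp_nat_mul]; norm_num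
    _ ≤ 3 ^ 60 := pow_le_pow_left₀ (Real.exp_pos _).le e1 60

/-- How large `n` has to be. -/
structure LargeEnough (n : ℕ) : Prop where
  ten_le : 10 ≤ n
  log_pos : 0 < Real.log n
  log_le : 4 * Real.log n ≤ n - 1
  const_le : 10 ^ 62 ≤ Real.exp (-20 + 0.38 * Real.log n)
  log_le_exp : 1000 * Real.log n ≤ Real.exp (-20 + 0.38 * Real.log n)
  log_le_exp' : 1000 * Real.log n ≤ Real.exp (0.06 * Real.log n)

lemma eventually_largeEnough : ∀ᶠ n : ℕ in Filter.atTop, LargeEnough n := by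
  have hlog : Filter.Tendsto (fun n : ℕ => Real.log n) Filter.atTop Filter.atTop :=
    Real.tendsto_log_atTop.comp tendsto_natCast_atTop_atTop
  have key : ∀ b c : ℝ, 0 < b → ∀ᶠ y : ℝ in Filter.atTop, c * y ≤ Real.exp (b * y) := by
    intro b c hb
    have h := tendsto_exp_mul_div_rpow_atTop 1 b hb
    filter_upwards [h.eventually_ge_atTop c, Filter.eventually_gt_atTop 0] with y h1 h2
    rwa [Real.rpow_one, le_div_iff₀ h2] at h1
  have k1 := hlog.eventually (key 1 5 one_pos)
  have k2 := hlog.eventually (key 0.38 (10 ^ 62 * Real.exp 20) (by norm_num))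
  have k3 := hlog.eventually (key 0.06 1000 (by norm_num))
  filter_upwards [k1, k2, k3, hlog.eventually_ge_atTop 1, Filter.eventually_ge_atTop 10]
    with n h1 h2 h3 h4 h5
  have hn : (0:ℝ) < n := by positivity
  rw [one_mul, Real.exp_log hn] at h1
  have h6 : 10 ^ 62 * Real.log n ≤ Real.exp (-20 + 0.38 * Real.log n) := by
    rw [Real.exp_add]
    calc 10 ^ 62 * Real.log n
        = Real.exp (-20) * (10 ^ 62 * Real.exp 20 * Real.log n) := by
          rw [Real.exp_neg]
          field_simp
      _ ≤ _ := mul_le_mul_of_nonneg_left h2 (Real.exp_pos _).le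
  exact ⟨h5, by linarith, by linarith, by linarith, by linarith, h3⟩

lemma defRate_le (n j : ℕ) : 0 ≤ defRate n j ∧ defRate n j ≤ 0.47 := by
  unfold defRate
  split_ifs <;> norm_num

lemma energyRate_le (n j : ℕ) : 0 ≤ energyRate n j ∧ energyRate n j ≤ 0.47 := by
  unfold energyRate
  split_ifs <;> norm_num

lemma exp_div_le {n : ℕ} (hn : 10 ≤ n) {α : ℝ} (hα : α ≤ 0.47) : Real.exp (α / n) ≤ 1.2 := by
  have hn' : (10:ℝ) ≤ n := by exact_mod_cast hn
  have h1 : α / n ≤ 0.1 := by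
    rw [div_le_iff₀ (by linarith)]
    linarith
  have h2 := (abs_le.1 (Real.abs_exp_sub_one_sub_id_le (x := 0.1) (by norm_num [abs_le]))).2
  linarith [Real.exp_le_exp.2 h1]

lemma LargeEnough.defExponent_bound {n j : ℕ} (h : LargeEnough n)
    (hj : (j:ℝ) ≤ 2 * n * Real.log n) :
    Real.exp (-20 + 0.38 * Real.log n) ≤ n * Real.exp (-defExponent n j) := by
  have hn : 0 < n := by linarith [h.ten_le]
  have hn' : (0:ℝ) < n := by exact_mod_cast hn
  have h1 := defExponent_le (j := j) hn
  have h2 : (j:ℝ) / n ≤ 2 * Real.log n := by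
    rw [div_le_iff₀ hn']
    linarith
  nth_rw 2 [← Real.exp_log hn']
  rw [← Real.exp_add]
  exact Real.exp_le_exp.2 (by linarith)

lemma LargeEnough.energyExponent_bound {n j : ℕ} (h : LargeEnough n)
    (hj : (j:ℝ) ≤ 2 * n * Real.log n) :
    Real.exp (0.06 * Real.log n) ≤ n * Real.exp (-energyExponent n j) := by
  have hn : 0 < n := by linarith [h.ten_le]
  have hn' : (0:ℝ) < n := by exact_mod_cast hn
  have h1 := energyExponent_le (j := j) hn
  have h2 : (j:ℝ) / n ≤ 2 * Real.log n := by
    rw [div_le_iff₀ hn']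
    linarith
  nth_rw 2 [← Real.exp_log hn']
  rw [← Real.exp_add]
  exact Real.exp_le_exp.2 (by linarith)

lemma LargeEnough.le_card {n M : ℕ} (h : LargeEnough n) (hM : (M:ℝ) ≤ 2 * n * Real.log n) :
    M ≤ n * (n - 1) / 2 := by
  have hn := h.ten_le
  rw [Nat.le_div_iff_mul_le two_pos]
  have h1 : ((n - 1 : ℕ) : ℝ) = n - 1 := by
    rw [Nat.cast_sub (by omega)]
    simp
  have h2 : (M:ℝ) * 2 ≤ n * (n - 1 : ℕ) := by
    rw [h1]
    nlinarith [h.log_le, (Nat.cast_nonneg n : (0:ℝ) ≤ n)]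
  exact_mod_cast h2

theorem LargeEnough.sum_stoppedPotential_le {n M : ℕ} (h : LargeEnough n)
    (hM : (M:ℝ) ≤ 2 * n * Real.log n) :
    ∑ σ : EdgeOrdering n, stoppedPotential (10 * Real.log n)
        (fun j => 2 * n * Real.exp (-defExponent n j))
        (fun j => 2 * n * Real.exp (-energyExponent n j)) M σ ≤
      Fintype.card (EdgeOrdering n) * (2 * Real.exp (10 * Real.log n / 2) +
        M * (2 * Real.exp (0.6 * (10 * Real.log n)))) := by
  have hn : 0 < n := by linarith [h.ten_le]
  have hn' : (0:ℝ) < n := by exact_mod_cast hn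
  have hlog := h.log_pos
  have hj : ∀ j ≤ M, (j:ℝ) ≤ 2 * n * Real.log n := fun j hj =>
    le_trans (by exact_mod_cast hj) hM
  refine _root_.sum_stoppedPotential_le (α := defRate n) (r := energyRate n) hn (h.le_card hM)
    (by linarith) ?_ ?_ (fun j => by positivity) (fun j => by positivity)
    (fun j => (defRate_le n j).1) (fun j => (energyRate_le n j).1) ?_ ?_
    (fun j _ => exp_div_le h.ten_le (defRate_le n j).2)
    (fun j _ => exp_div_le h.ten_le (energyRate_le n j).2) ?_ ?_ ?_ ?_ M le_rfl
  · simp [defExponent]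
  · simp [energyExponent]
  · intro j _
    rw [defExponent_succ, neg_add, Real.exp_add]
    ring
  · intro j _
    rw [energyExponent_succ, neg_add, Real.exp_add]
    ring
  · intro j hjM
    linarith [h.defExponent_bound (hj (j + 1) hjM), h.log_le_exp]
  · intro j hjM
    linarith [h.energyExponent_bound (hj (j + 1) hjM), h.log_le_exp']
  · intro j hjM hα U R hU _ hR0 hR
    have hU1 : n * Real.exp (-defExponent n j) ≤ U := by linarith
    have hU2 := (h.defExponent_bound (hj j hjM.le)).trans hU1
    have hU3 := h.const_le.trans hU2
    rcases lt_or_ge j (10 ^ 31 * n) with h1 | h1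
    · have hα' : defRate n j = 2 / 10 ^ 30 := if_pos h1
      have hA := defExponent_of_lt hn h1
      refine deficiency_drift (δ := 1 / 10 ^ 30) hn' hU1 (by linarith) hR0 hR ?_ ?_
      · rw [hα', energyExponent_of_lt h1]
        have h2 : Real.exp (-60) ≤ Real.exp (2 * 0 - 3 * defExponent n j) :=
          Real.exp_le_exp.2 (by linarith)
        have h3 := inv_three_pow_le_exp_neg_sixty
        have h4 : (2:ℝ) / 10 ^ 30 / 1.96 + 1 / 10 ^ 30 ≤ 0.2475 * (1 / 3 ^ 60) := by norm_num
        exact h4.trans (mul_le_mul_of_nonneg_left (h3.trans h2) (by norm_num))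
      · have h2 : (j:ℝ) ≤ 10 ^ 31 * n := by exact_mod_cast h1.le
        nlinarith
    · have h2 : (10 ^ 31 + 70) * n ≤ j := by
        by_contra hcon
        exact hα (by rw [defRate, if_neg (by omega), if_pos (by omega)])
      have hα' : defRate n j = 0.31 := by rw [defRate, if_neg (by omega), if_neg (by omega)]
      refine deficiency_drift (δ := 0.08) hn' hU1 (by linarith) hR0 hR ?_ ?_
      · rw [hα']
        have h3 := Real.one_le_exp (energyExponent_sub_ge hn h2)
        have h4 : (0.31:ℝ) / 1.96 + 0.08 ≤ 0.2475 := by norm_num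
        linarith
      · nlinarith [hj j hjM.le, h.log_le_exp]
  · intro j hjM hr U R hU0 hU hR _
    have h1 : 10 ^ 31 * n ≤ j := by
      by_contra hcon
      exact hr (if_pos (by omega))
    have hr' : energyRate n j = 0.47 := if_neg (by omega)
    obtain ⟨h2, h3⟩ := energyExponent_sub_le hn h1
    have hR1 : n * Real.exp (-energyExponent n j) ≤ R := by linarith
    have hR2 := (h.energyExponent_bound (hj j hjM.le)).trans hR1
    rw [hr']
    refine minEnergy_drift hn' hU0 hU hR1 h2 h3 ?_
    nlinarith [hj j hjM.le, h.log_le_exp']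

theorem LargeEnough.Pr_ge {n M : ℕ} (h : LargeEnough n)
    (hM0 : 31 * (10 ^ 31 + 70) * (n:ℝ) ≤ M) (hM : (M:ℝ) ≤ 2 * n * Real.log n) :
    1 - 4 / (n:ℝ) ^ 2 ≤ Pr n (fun σ => (n:ℝ) / 2 * (1 - Real.exp (-(3 * (M:ℝ)) / (10 * n))) ≤
      matchNum (KonigProc σ M)) := by
  have hn : 0 < n := by linarith [h.ten_le]
  have hn' : (10:ℝ) ≤ n := by exact_mod_cast h.ten_le
  have hn0 : (0:ℝ) < n := by linarith
  have hu : 2 * n * Real.exp (-defExponent n M) ≤ n * Real.exp (-(3 * (M:ℝ)) / (10 * n)) := by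
    have h1 : (10 ^ 31 + 70) * n ≤ M := by
      have : (10 ^ 31 + 70) * (n:ℝ) ≤ M := by nlinarith
      exact_mod_cast this
    have h2 : 31 * (10 ^ 31 + 70) ≤ (M:ℝ) / n := by rwa [le_div_iff₀ hn0]
    have h3 : -(3 * (M:ℝ)) / (10 * n) = -(0.3 * (M / n)) := by
      field_simp
      norm_num
      ring
    have e1 : (2:ℝ) ≤ Real.exp 1 := by linarith [Real.exp_one_gt_d9]
    rw [defExponent_of_ge hn h1, h3, mul_comm 2, mul_assoc]
    refine mul_le_mul_of_nonneg_left ?_ hn0.le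
    refine (mul_le_mul_of_nonneg_right e1 (Real.exp_pos _).le).trans ?_
    rw [← Real.exp_add]
    exact Real.exp_le_exp.2 (by linarith)
  have hexp : ∀ k : ℕ, Real.exp (k * Real.log n) = (n:ℝ) ^ k := fun k => by
    rw [Real.exp_nat_mul, Real.exp_log hn0]
  have hP := Pr_ge_of_sum_le (B := Real.exp (10 * Real.log n))
    (A := fun σ => (n:ℝ) / 2 * (1 - Real.exp (-(3 * (M:ℝ)) / (10 * n))) ≤
      matchNum (KonigProc σ M)) (Real.exp_pos _) (fun σ => ?_) (fun σ hσ => ?_)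
    (h.sum_stoppedPotential_le hM)
  · refine le_trans (sub_le_sub_left ?_ 1) hP
    have e5 : Real.exp (10 * Real.log n / 2) = (n:ℝ) ^ 5 := by
      rw [← hexp]
      congr 1
      push_cast
      ring
    have e6 : Real.exp (0.6 * (10 * Real.log n)) = (n:ℝ) ^ 6 := by
      rw [← hexp]
      congr 1
      push_cast
      ring
    have e10 : Real.exp (10 * Real.log n) = (n:ℝ) ^ 10 := by
      rw [← hexp]
      push_cast
      rfl
    rw [e5, e6, e10, div_le_div_iff₀ (by positivity) (by positivity)]
    have h1 : 2 * (M:ℝ) ≤ n ^ 2 := by nlinarith [h.log_le]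
    have h2 : (n:ℝ) ^ 7 ≤ n ^ 10 := pow_le_pow_right₀ (by linarith) (by norm_num)
    have h3 : 2 * (M:ℝ) * n ^ 8 ≤ n ^ 2 * n ^ 8 :=
      mul_le_mul_of_nonneg_right h1 (by positivity)
    have h4 : (0:ℝ) < n ^ 10 := by positivity
    calc (2 * (n:ℝ) ^ 5 + M * (2 * (n:ℝ) ^ 6)) * (n:ℝ) ^ 2
        = 2 * (n:ℝ) ^ 7 + 2 * M * (n:ℝ) ^ 8 := by ring
      _ ≤ 2 * (n:ℝ) ^ 10 + (n:ℝ) ^ 2 * (n:ℝ) ^ 8 := by linarith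
      _ = 3 * (n:ℝ) ^ 10 := by ring
      _ ≤ 4 * (n:ℝ) ^ 10 := by linarith
  · unfold stoppedPotential expPotential
    split_ifs <;> positivity
  · rw [stoppedPotential, if_neg]
    intro htrack
    refine hσ ?_
    have h1 := (htrack M le_rfl).1
    unfold deficiency at h1
    linarith

/-- There exist constants `γ, K > 0` such that for all sufficiently large even `n` and every
`m` with `γn ≤ m ≤ 2 n log n`, with probability at least `1 − K n⁻²` the König process
satisfies `ν(G_m) ≥ (n/2)(1 − e^{−3m/(10n)})`. -/
theorem koenig_process_large_matching :
    ∃ γ K : ℝ, 0 < γ ∧ 0 < K ∧ ∃ n₀ : ℕ, ∀ k : ℕ, n₀ ≤ 2*k →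
      ∀ m : ℕ, γ * (2*k) ≤ (m : ℝ) → (m : ℝ) ≤ 2 * (2*k) * Real.log (2*k) →
        1 - K / (2*k : ℝ)^2 ≤
          Pr (2*k) (fun σ =>
            ((2*k : ℝ)/2) * (1 - Real.exp (-(3*(m:ℝ)) / (10*(2*k)))) ≤
              (matchNum (KonigProc σ m) : ℝ)) := by
  obtain ⟨n₀, hn₀⟩ := Filter.eventually_atTop.1 eventually_largeEnough
  refine ⟨31 * (10 ^ 31 + 70), 4, by norm_num, by norm_num, n₀, fun k hk m h1 h2 => ?_⟩
  have h := (hn₀ (2 * k) hk).Pr_ge (M := m) (by push_cast; exact h1) (by push_cast; exact h2)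
  push_cast at h
  exact h
end
end

section
/- Let X be a binomial random variable with parameters k and p, and set μ = kp. Let η > 0 and let 0 < δ ≤ 1 satisfy μ > 0, δμ ≥ 1 and δ(2 + log(1/δ)) + log(δμ)/μ ≤ η. Then P(X ≤ δμ) ≤ e^{−(1−η)μ}. -/
/-- Chernoff's bound for the lower tail of the binomial distribution, with weight `t ^ (X - a)`. -/
theorem binomial_lower_tail_le_rpow (k : ℕ) {p t : ℝ} (hp0 : 0 ≤ p) (hp1 : p ≤ 1)
    (ht0 : 0 < t) (ht1 : t ≤ 1) (a : ℝ) :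
    ∑ s ∈ (Finset.range (k+1)).filter (fun s : ℕ => (s : ℝ) ≤ a),
        (k.choose s : ℝ) * p^s * (1-p)^(k-s)
      ≤ (t * p + (1 - p)) ^ k * t ^ (-a) := by
  have hq : 0 ≤ 1 - p := sub_nonneg.2 hp1
  calc _ ≤ ∑ s ∈ (Finset.range (k+1)).filter (fun s : ℕ => (s : ℝ) ≤ a),
        (k.choose s : ℝ) * p^s * (1-p)^(k-s) * (t ^ s * t ^ (-a)) := by
        refine Finset.sum_le_sum fun s hs => le_mul_of_one_le_right (by positivity) ?_
        rw [← Real.rpow_natCast t s, ← Real.rpow_add ht0]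
        exact Real.one_le_rpow_of_pos_of_le_one_of_nonpos ht0 ht1
          (by linarith [(Finset.mem_filter.1 hs).2])
    _ ≤ ∑ s ∈ Finset.range (k+1),
        (k.choose s : ℝ) * p^s * (1-p)^(k-s) * (t ^ s * t ^ (-a)) :=
        Finset.sum_le_sum_of_subset_of_nonneg (Finset.filter_subset _ _)
          fun s _ _ => by positivity
    _ = (t * p + (1 - p)) ^ k * t ^ (-a) := by
        rw [add_pow, Finset.sum_mul]
        refine Finset.sum_congr rfl fun s _ => ?_
        rw [mul_pow]
        ring


/-- Lower-tail bound for the binomial distribution: if `X ~ Bin(k, p)`, `μ = kp > 0`,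
`0 < δ ≤ 1` with `δμ ≥ 1` and `δ(2 + log(1/δ)) + log(δμ)/μ ≤ η`, then
`P(X ≤ δμ) ≤ e^{−(1−η)μ}`. -/
theorem binomial_lower_tail (k : ℕ) (p : ℝ) (hp0 : 0 ≤ p) (hp1 : p ≤ 1)
    (η δ : ℝ) (hη : 0 < η) (hδ0 : 0 < δ) (hδ1 : δ ≤ 1)
    (hμ : 0 < (k : ℝ) * p) (hδμ : 1 ≤ δ * ((k : ℝ) * p))
    (hcond : δ * (2 + Real.log (1/δ)) + Real.log (δ * ((k : ℝ) * p)) / ((k : ℝ) * p) ≤ η) :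
    ∑ s ∈ (Finset.range (k+1)).filter (fun s : ℕ => (s : ℝ) ≤ δ * ((k : ℝ) * p)),
        (k.choose s : ℝ) * p^s * (1-p)^(k-s)
      ≤ Real.exp (-(1-η) * ((k : ℝ) * p)) := by
  refine (binomial_lower_tail_le_rpow k hp0 hp1 hδ0 hδ1 _).trans ?_
  have hbase : (δ * p + (1 - p)) ^ k ≤ Real.exp (-((1 - δ) * (k * p))) := by
    calc (δ * p + (1 - p)) ^ k ≤ Real.exp (-((1 - δ) * p)) ^ k := by
          refine pow_le_pow_left₀ (by nlinarith) ?_ k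
          linarith [Real.add_one_le_exp (-((1 - δ) * p))]
      _ = Real.exp (-((1 - δ) * (k * p))) := by
          rw [← Real.exp_nat_mul]
          ring_nf
  have hη_mul := mul_le_mul_of_nonneg_right hcond hμ.le
  rw [add_mul, div_mul_cancel₀ _ hμ.ne', one_div, Real.log_inv] at hη_mul
  calc _ ≤ Real.exp (-((1 - δ) * (k * p))) * δ ^ (-(δ * (k * p))) := by gcongr
    _ = Real.exp (-((1 - δ) * (k * p)) + Real.log δ * -(δ * (k * p))) := by
        rw [Real.rpow_def_of_pos hδ0, ← Real.exp_add]
    _ ≤ _ := by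
        refine Real.exp_le_exp.2 ?_
        nlinarith [Real.log_nonneg hδμ]
end
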